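/- Let f : ℕ → ℂ be in the class F₁. Then Σ_{n ≤ x} f(n) = π²·x² / (12·log x) + O( x² / (log x)² ) as x → ∞; i.e., there exist constants c > 0 and x₀ ≥ 3 such that |Σ_{n ≤ x} f(n) − π²x²/(12 log x)| ≤ c·x²/(log x)² for all x ≥ x₀. -/

import Mathlib

section
open Complex

noncomputable def hz (n : ℕ) (s : ℂ) : ℂ :=
  (n : ℂ) ^ (-s) - (((n + 1 : ℕ) : ℂ) ^ (1 - s) - (n : ℂ) ^ (1 - s)) / (1 - s)

lemma hz_aux (n : ℕ) (hn : 1 ≤ n) (s : ℂ) (hs1 : s ≠ 1) (B : ℝ)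
    (hB : ∀ u : ℝ, n ≤ u → u ≤ n + 1 → ‖(n : ℂ) ^ (-s) - (u : ℂ) ^ (-s)‖ ≤ B) :
    ‖hz n s‖ ≤ B := by
  have hn0 : (0 : ℝ) < n := by exact_mod_cast hn
  have hs : (1 - s) ≠ 0 := sub_ne_zero.mpr (Ne.symm hs1)
  let φ : ℝ → ℂ := fun u => (n : ℂ) ^ (-s) * u - (u : ℂ) ^ (1 - s) / (1 - s)
  have hd : ∀ u ∈ Set.Icc (n : ℝ) (n + 1), HasDerivWithinAt φ ((n : ℂ) ^ (-s) - (u : ℂ) ^ (-s))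
      (Set.Icc (n : ℝ) (n + 1)) u := by
    intro u hu
    have hu0 : 0 < u := lt_of_lt_of_le hn0 hu.1
    have h1 : HasDerivAt (fun u : ℝ => (u : ℂ) ^ (1 - s) / (1 - s)) ((u : ℂ) ^ (-s)) u := by
      have := hasDerivAt_ofReal_cpow_const' (x := u) hu0.ne' (r := -s) (by
        intro h; apply hs; linear_combination h)
      have e : (1 : ℂ) - s = -s + 1 := by ring
      rw [e]; exact this
    have h2 : HasDerivAt (fun u : ℝ => (n : ℂ) ^ (-s) * u) ((n : ℂ) ^ (-s)) u := by
      simpa using (Complex.ofRealCLM.hasDerivAt (x := u)).const_mul ((n : ℂ) ^ (-s))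
    exact (h2.sub h1).hasDerivWithinAt
  have := norm_image_sub_le_of_norm_deriv_le_segment' hd (C := B)
    (fun u hu => hB u hu.1 hu.2.le) (n + 1) (by simp)
  have e : φ (n + 1) - φ n = hz n s := by
    simp only [φ, hz]; push_cast; field_simp; ring
  rw [e] at this
  simpa using this

lemma hz_bound1 (n : ℕ) (hn : 1 ≤ n) (s : ℂ) (hs1 : s ≠ 1) (hs : 0 < s.re) :
    ‖hz n s‖ ≤ 2 * (n : ℝ) ^ (-s.re) := by
  have hn0 : (0 : ℝ) < n := by exact_mod_cast hn
  apply hz_aux n hn s hs1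
  intro u hu _
  have hu0 : 0 < u := lt_of_lt_of_le hn0 hu
  have e1 : ‖(n : ℂ) ^ (-s)‖ = (n : ℝ) ^ (-s.re) := by
    have := norm_cpow_eq_rpow_re_of_pos hn0 (-s)
    simpa using this
  have e2 : ‖(u : ℂ) ^ (-s)‖ = u ^ (-s.re) := by
    simpa using norm_cpow_eq_rpow_re_of_pos hu0 (-s)
  have : u ^ (-s.re) ≤ (n : ℝ) ^ (-s.re) :=
    Real.rpow_le_rpow_of_nonpos hn0 hu (by linarith)
  calc _ ≤ _ := norm_sub_le _ _
    _ ≤ _ := by rw [e1, e2]; linarith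

lemma hz_bound2 (n : ℕ) (hn : 1 ≤ n) (s : ℂ) (hs1 : s ≠ 1) (hs : 0 < s.re) :
    ‖hz n s‖ ≤ ‖s‖ * (n : ℝ) ^ (-s.re - 1) := by
  have hn0 : (0 : ℝ) < n := by exact_mod_cast hn
  have hs0 : s ≠ 0 := by rintro rfl; simp at hs
  apply hz_aux n hn s hs1
  intro u hu hu1
  have hd : ∀ v ∈ Set.Icc (n : ℝ) u, HasDerivWithinAt (fun v : ℝ => (v : ℂ) ^ (-s))
      (-s * (v : ℂ) ^ (-s - 1)) (Set.Icc (n : ℝ) u) v := by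
    intro v hv
    have hv0 : 0 < v := lt_of_lt_of_le hn0 hv.1
    exact (hasDerivAt_ofReal_cpow_const hv0.ne' (by simpa using hs0)).hasDerivWithinAt
  have := norm_image_sub_le_of_norm_deriv_le_segment' hd (C := ‖s‖ * (n : ℝ) ^ (-s.re - 1))
    (fun v hv => by
      have hv0 : 0 < v := lt_of_lt_of_le hn0 hv.1
      rw [norm_mul, norm_neg, norm_cpow_eq_rpow_re_of_pos hv0]
      gcongr
      simp only [sub_re, neg_re, one_re]
      exact Real.rpow_le_rpow_of_nonpos hn0 hv.1 (by linarith)) u (by simp [hu])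
  rw [norm_sub_rev]
  refine this.trans ?_
  apply mul_le_of_le_one_right (by positivity); linarith

lemma hz_bound (n : ℕ) (hn : 1 ≤ n) (s : ℂ) (hs1 : s ≠ 1) (hs : 0 < s.re) (θ : ℝ) (h0 : 0 ≤ θ)
    (h1 : θ ≤ 1) : ‖hz n s‖ ≤ 2 * ‖s‖ ^ θ * (n : ℝ) ^ (-s.re - θ) := by
  have hn0 : (0 : ℝ) < n := by exact_mod_cast hn
  have b1 := hz_bound1 n hn s hs1 hs
  have b2 := hz_bound2 n hn s hs1 hs
  have e : ‖hz n s‖ = ‖hz n s‖ ^ (1 - θ) * ‖hz n s‖ ^ θ := by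
    rw [← Real.rpow_add_of_nonneg (norm_nonneg _) (by linarith) h0]; simp
  rw [e]
  calc _ ≤ (2 * (n : ℝ) ^ (-s.re)) ^ (1 - θ) * (‖s‖ * (n : ℝ) ^ (-s.re - 1)) ^ θ := by
        gcongr
    _ = 2 ^ (1 - θ) * ‖s‖ ^ θ * (n : ℝ) ^ (-s.re - θ) := by
        rw [Real.mul_rpow (by norm_num) (by positivity), Real.mul_rpow (by positivity) (by positivity),
          ← Real.rpow_mul hn0.le, ← Real.rpow_mul hn0.le]
        have : -s.re - θ = (-s.re) * (1 - θ) + (-s.re - 1) * θ := by ring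
        rw [this, Real.rpow_add hn0]; ring
    _ ≤ _ := by
        gcongr
        calc (2 : ℝ) ^ (1 - θ) ≤ 2 ^ (1 : ℝ) := Real.rpow_le_rpow_of_exponent_le (by norm_num) (by linarith)
          _ = 2 := by norm_num

lemma hz_hasSum (s : ℂ) (hs : 1 < s.re) :
    HasSum (fun n : ℕ => hz (n + 1) s) (riemannZeta s - 1 / (s - 1)) := by
  have hs1 : s ≠ 1 := by rintro rfl; simp at hs
  have hsm : Summable (fun n : ℕ => hz (n + 1) s) := by
    apply Summable.of_norm_bounded (g := fun n : ℕ => 2 * ((n + 1 : ℕ) : ℝ) ^ (-s.re))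
    · apply Summable.mul_left
      exact (summable_nat_add_iff 1).mpr (Real.summable_nat_rpow.mpr (by linarith))
    · intro n; exact hz_bound1 (n + 1) (by omega) s hs1 (by linarith)
  have h1 : HasSum (fun n : ℕ => ((n + 1 : ℕ) : ℂ) ^ (-s)) (riemannZeta s) := by
    have hz := zeta_eq_tsum_one_div_nat_add_one_cpow hs
    have : Summable (fun n : ℕ => ((n + 1 : ℕ) : ℂ) ^ (-s)) := by
      apply Summable.of_norm_bounded (g := fun n : ℕ => ((n + 1 : ℕ) : ℝ) ^ (-s.re))
      · exact (summable_nat_add_iff 1).mpr (Real.summable_nat_rpow.mpr (by linarith))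
      · intro n
        have := norm_cpow_eq_rpow_re_of_pos (x := ((n + 1 : ℕ) : ℝ)) (by positivity) (-s)
        rw [ofReal_natCast] at this
        rw [this]; simp
    rw [hz]
    convert this.hasSum using 3 with n
    rw [cpow_neg]; push_cast; simp
  have h2 : HasSum (fun n : ℕ => hz (n + 1) s - ((n + 1 : ℕ) : ℂ) ^ (-s)) (- (1 / (s - 1))) := by
    rw [(hsm.sub h1.summable).hasSum_iff_tendsto_nat]
    have e : ∀ N : ℕ, ∑ n ∈ Finset.range N, (hz (n + 1) s - ((n + 1 : ℕ) : ℂ) ^ (-s)) =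
        (1 - ((N + 1 : ℕ) : ℂ) ^ (1 - s)) / (1 - s) := by
      intro N
      induction N with
      | zero => simp
      | succ N ih => rw [Finset.sum_range_succ, ih, hz]; ring
    simp_rw [e]
    have : Filter.Tendsto (fun N : ℕ => ((N + 1 : ℕ) : ℂ) ^ (1 - s)) Filter.atTop (nhds 0) := by
      rw [tendsto_zero_iff_norm_tendsto_zero]
      have e2 : ∀ N : ℕ, ‖((N + 1 : ℕ) : ℂ) ^ (1 - s)‖ = ((N + 1 : ℕ) : ℝ) ^ (-(s.re - 1)) := by
        intro N
        have := norm_cpow_eq_rpow_re_of_pos (x := ((N + 1 : ℕ) : ℝ)) (by positivity) (1 - s)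
        rw [ofReal_natCast] at this
        rw [this]; simp
      simp_rw [e2]
      exact (tendsto_rpow_neg_atTop (by linarith)).comp
        (tendsto_natCast_atTop_atTop.comp (Filter.tendsto_add_atTop_nat 1))
    have := ((tendsto_const_nhds (x := (1 : ℂ))).sub this).div_const (1 - s)
    convert this using 2
    rw [sub_zero, ← div_neg, neg_sub]
  convert h2.add h1 using 1
  · ext n; ring
  · ring

/-- continuation -/
noncomputable def Gz (s : ℂ) : ℂ := ∑' n : ℕ, hz (n + 1) s + 1 / (s - 1)

lemma Gz_eq (s : ℂ) (hs : 1 < s.re) : Gz s = riemannZeta s := by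
  rw [Gz, (hz_hasSum s hs).tsum_eq]; ring

lemma Gz_bound : ∃ C > 0, ∀ s : ℂ, 1 - 1 / 60 < s.re → s.re < 3 → 1 / 2 ≤ |s.im| →
    ‖Gz s‖ ≤ C * |s.im| ^ (1 / 30 : ℝ) := by
  have hsm : Summable (fun n : ℕ => ((n + 1 : ℕ) : ℝ) ^ (-1 - 1 / 60 : ℝ)) :=
    (summable_nat_add_iff 1).mpr (Real.summable_nat_rpow.mpr (by norm_num))
  set S := ∑' n : ℕ, ((n + 1 : ℕ) : ℝ) ^ (-1 - 1 / 60 : ℝ) with hS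
  have hS0 : 0 ≤ S := tsum_nonneg fun n => by positivity
  refine ⟨14 * S + 4, by positivity, ?_⟩
  intro s h1 h2 h3
  have hs1 : s ≠ 1 := by rintro rfl; norm_num at h3
  have hb : ∀ n : ℕ, ‖hz (n + 1) s‖ ≤ 2 * ‖s‖ ^ (1 / 30 : ℝ) * ((n + 1 : ℕ) : ℝ) ^ (-1 - 1 / 60 : ℝ) := by
    intro n
    refine (hz_bound (n + 1) (by omega) s hs1 (by linarith) (1 / 30) (by norm_num) (by norm_num)).trans ?_
    exact mul_le_mul_of_nonneg_left (Real.rpow_le_rpow_of_exponent_le (by push_cast; linarith) (by linarith)) (by positivity)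
  have h4 : ‖∑' n : ℕ, hz (n + 1) s‖ ≤ 2 * ‖s‖ ^ (1 / 30 : ℝ) * S := by
    refine tsum_of_norm_bounded (hsm.hasSum.mul_left _) hb
  have h5 : ‖s‖ ≤ 7 * |s.im| := by
    have := Complex.norm_le_abs_re_add_abs_im s
    rw [abs_of_pos (by linarith)] at this; linarith
  have h6 : ‖s‖ ^ (1 / 30 : ℝ) ≤ 7 * |s.im| ^ (1 / 30 : ℝ) := by
    calc _ ≤ (7 * |s.im|) ^ (1 / 30 : ℝ) := by gcongr
      _ = 7 ^ (1 / 30 : ℝ) * |s.im| ^ (1 / 30 : ℝ) := Real.mul_rpow (by norm_num) (by positivity)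
      _ ≤ _ := by
        gcongr
        calc (7 : ℝ) ^ (1 / 30 : ℝ) ≤ 7 ^ (1 : ℝ) := Real.rpow_le_rpow_of_exponent_le (by norm_num) (by norm_num)
          _ = 7 := by norm_num
  have h7 : ‖1 / (s - 1)‖ ≤ 2 := by
    rw [norm_div, norm_one]
    have : |s.im| ≤ ‖s - 1‖ := by simpa using Complex.abs_im_le_norm (s - 1)
    rw [div_le_iff₀ (by linarith)]; linarith
  have h8 : 1 / 2 ≤ |s.im| ^ (1 / 30 : ℝ) := by
    calc (1 / 2 : ℝ) = (1 / 2) ^ (1 : ℝ) := by norm_num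
      _ ≤ (1 / 2 : ℝ) ^ (1 / 30 : ℝ) := Real.rpow_le_rpow_of_exponent_ge (by norm_num) (by norm_num) (by norm_num)
      _ ≤ _ := by gcongr
  calc ‖Gz s‖ ≤ 2 * ‖s‖ ^ (1 / 30 : ℝ) * S + 2 := by
        rw [Gz]; exact (norm_add_le _ _).trans (add_le_add h4 h7)
    _ ≤ 2 * (7 * |s.im| ^ (1 / 30 : ℝ)) * S + 4 * |s.im| ^ (1 / 30 : ℝ) := by gcongr; linarith
    _ = _ := by ring

lemma hz_diff (n : ℕ) (hn : 1 ≤ n) (s : ℂ) (hs : s ≠ 1) : DifferentiableAt ℂ (hz n) s := by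
  have hn0 : (n : ℂ) ≠ 0 := by exact_mod_cast (by omega : n ≠ 0)
  have hn1 : ((n + 1 : ℕ) : ℂ) ≠ 0 := by exact_mod_cast (by omega : n + 1 ≠ 0)
  unfold hz
  have : 1 - s ≠ 0 := sub_ne_zero.mpr hs.symm
  fun_prop (disch := first | assumption | (left; assumption))

lemma Gz_diff (s : ℂ) (h1 : 1 - 1 / 60 < s.re) (h3 : 1 / 2 < |s.im|) :
    DifferentiableAt ℂ Gz s := by
  let U : Set ℂ := {z | 1 - 1 / 60 < z.re} ∩ {z | 1 / 2 < |z.im|} ∩ {z | ‖z‖ < ‖s‖ + 1}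
  have hU : IsOpen U := by
    refine ((isOpen_lt continuous_const continuous_re).inter
      (isOpen_lt continuous_const (continuous_abs.comp continuous_im))).inter
      (isOpen_lt continuous_norm continuous_const)
  have hsU : s ∈ U := ⟨⟨h1, h3⟩, by simp⟩
  have hsm : Summable (fun n : ℕ => 2 * (‖s‖ + 1) ^ (1 / 30 : ℝ) * ((n + 1 : ℕ) : ℝ) ^ (-1 - 1 / 60 : ℝ)) :=
    ((summable_nat_add_iff 1).mpr (Real.summable_nat_rpow.mpr (by norm_num))).mul_left _
  have hne : ∀ z ∈ U, z ≠ 1 := by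
    rintro z ⟨⟨_, hz⟩, _⟩ rfl
    norm_num at hz
  have hd : DifferentiableOn ℂ (fun z => ∑' n : ℕ, hz (n + 1) z) U := by
    refine differentiableOn_tsum_of_summable_norm hsm (fun n z hz' => ?_) hU (fun n z hz' => ?_)
    · exact (hz_diff (n + 1) (by omega) z (hne z hz')).differentiableWithinAt
    · have h1 : 1 - 1 / 60 < z.re := hz'.1.1
      have h2 : ‖z‖ < ‖s‖ + 1 := hz'.2
      refine (hz_bound (n + 1) (by omega) z (hne z hz') (by linarith) (1 / 30) (by norm_num) (by norm_num)).trans ?_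
      refine mul_le_mul ?_ (Real.rpow_le_rpow_of_exponent_le (by push_cast; linarith) (by linarith)) (by positivity) (by positivity)
      gcongr
  have := hd.differentiableAt (hU.mem_nhds hsU)
  have h1 : DifferentiableAt ℂ (fun z : ℂ => 1 / (z - 1)) s :=
    (differentiableAt_const _).div (by fun_prop) (sub_ne_zero.mpr (hne s hsU))
  exact this.add h1

lemma zeta_iter_bound : ∃ C > 0, ∀ s : ℂ, 1 < s.re → s.re ≤ 2 → 1 ≤ |s.im| → ∀ j ≤ 3,
    ‖iteratedDeriv j riemannZeta s‖ ≤ C * |s.im| ^ (1 / 30 : ℝ) := by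
  obtain ⟨C, hC, hb⟩ := Gz_bound
  refine ⟨6 * (C * 2) * 120 ^ 3, by positivity, ?_⟩
  intro s h1 h2 h3 j hj
  have heq : riemannZeta =ᶠ[nhds s] Gz := by
    filter_upwards [(isOpen_lt continuous_const continuous_re).mem_nhds h1] with z hz
    exact (Gz_eq z hz).symm
  rw [heq.iteratedDeriv_eq]
  have hball : ∀ z, ‖z - s‖ ≤ 1 / 120 → 1 - 1 / 60 < z.re ∧ z.re < 3 ∧ 1 / 2 < |z.im| ∧ |z.im| ≤ 2 * |s.im| := by
    intro z hz
    have a1 := (Complex.abs_re_le_norm (z - s)).trans hz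
    have a2 := (Complex.abs_im_le_norm (z - s)).trans hz
    rw [sub_re, abs_le] at a1
    rw [sub_im] at a2
    have a3 : |s.im| - |z.im| ≤ 1 / 120 := by
      have := abs_sub_abs_le_abs_sub s.im z.im
      rw [abs_sub_comm] at this; linarith
    have a4 : |z.im| - |s.im| ≤ 1 / 120 := (abs_sub_abs_le_abs_sub _ _).trans a2
    refine ⟨by linarith, by linarith, by linarith, by linarith⟩
  have hd : DiffContOnCl ℂ Gz (Metric.ball s (1 / 120)) := by
    apply DifferentiableOn.diffContOnCl
    intro z hz
    have := hball z (by
      have := Metric.closure_ball_subset_closedBall hz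
      rwa [Metric.mem_closedBall, dist_eq_norm] at this)
    exact (Gz_diff z this.1 this.2.2.1).differentiableWithinAt
  have := Complex.norm_iteratedDeriv_le_of_forall_mem_sphere_norm_le j (R := 1 / 120) (by norm_num) hd
    (C := C * (2 * |s.im| ^ (1 / 30 : ℝ))) (fun z hz => by
      have hz' := hball z (by rw [mem_sphere_iff_norm] at hz; exact hz.le)
      refine (hb z hz'.1 hz'.2.1 hz'.2.2.1.le).trans ?_
      gcongr
      calc |z.im| ^ (1 / 30 : ℝ) ≤ (2 * |s.im|) ^ (1 / 30 : ℝ) := by gcongr; exact hz'.2.2.2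
        _ = 2 ^ (1 / 30 : ℝ) * |s.im| ^ (1 / 30 : ℝ) := Real.mul_rpow (by norm_num) (by positivity)
        _ ≤ _ := by
          gcongr
          calc (2 : ℝ) ^ (1 / 30 : ℝ) ≤ 2 ^ (1 : ℝ) := Real.rpow_le_rpow_of_exponent_le (by norm_num) (by norm_num)
            _ = 2 := by norm_num)
  refine this.trans ?_
  have f1 : (j.factorial : ℝ) ≤ 6 := by
    have := Nat.factorial_le hj
    exact_mod_cast this
  have f2 : (120 : ℝ) ^ j ≤ 120 ^ 3 := pow_le_pow_right₀ (by norm_num) hj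
  calc _ = j.factorial * (C * (2 * |s.im| ^ (1 / 30 : ℝ))) * 120 ^ j := by
        rw [one_div_pow, div_div_eq_mul_div, div_one]
    _ ≤ 6 * (C * (2 * |s.im| ^ (1 / 30 : ℝ))) * 120 ^ 3 := by gcongr
    _ = _ := by ring

end

section
open Complex

lemma zeta_near_one : ∃ C > 0, ∀ x : ℝ, 0 < x → x ≤ 1 → ‖riemannZeta (1 + x)‖ ≤ C / x := by
  have hsm : Summable (fun n : ℕ => ((n + 1 : ℕ) : ℝ) ^ (-2 : ℝ)) :=
    (summable_nat_add_iff 1).mpr (Real.summable_nat_rpow.mpr (by norm_num))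
  set S := ∑' n : ℕ, ((n + 1 : ℕ) : ℝ) ^ (-2 : ℝ) with hS
  have hS0 : 0 ≤ S := tsum_nonneg fun n => by positivity
  refine ⟨1 + 2 * S, by positivity, ?_⟩
  intro x hx hx1
  have hre : (1 + (x : ℂ)).re = 1 + x := by simp
  have hne : (1 + (x : ℂ)) ≠ 1 := by simpa using hx.ne'
  have hsum := hz_hasSum (1 + x) (by rw [hre]; linarith)
  have h4 : ‖riemannZeta (1 + x) - 1 / ((1 + x : ℂ) - 1)‖ ≤ 2 * S := by
    rw [← hsum.tsum_eq]
    refine tsum_of_norm_bounded (hsm.hasSum.mul_left _) (fun n => ?_)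
    refine (hz_bound2 (n + 1) (by omega) _ hne (by rw [hre]; linarith)).trans ?_
    refine mul_le_mul ?_ (Real.rpow_le_rpow_of_exponent_le (by push_cast; linarith) (by rw [hre]; linarith)) (by positivity) (by positivity)
    have : (1 + (x : ℂ)) = ((1 + x : ℝ) : ℂ) := by push_cast; rfl
    rw [this, Complex.norm_of_nonneg (by linarith)]; linarith
  have h5 : ‖1 / ((1 + x : ℂ) - 1)‖ = 1 / x := by
    simp [abs_of_pos hx]
  calc _ = ‖(riemannZeta (1 + x) - 1 / ((1 + x : ℂ) - 1)) + 1 / ((1 + x : ℂ) - 1)‖ := by congr 1; ring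
    _ ≤ 2 * S + 1 / x := by rw [← h5]; exact (norm_add_le _ _).trans (by gcongr)
    _ ≤ 2 * S / x + 1 / x := by
        gcongr
        rw [le_div_iff₀ hx]; nlinarith
    _ = _ := by ring

lemma zeta_341 (x : ℝ) (hx : 0 < x) (y : ℝ) :
    1 ≤ ‖riemannZeta (1 + x)‖ ^ 3 * ‖riemannZeta (1 + x + I * y)‖ ^ 4 *
      ‖riemannZeta (1 + x + 2 * I * y)‖ := by
  have := DirichletCharacter.norm_LFunction_product_ge_one (N := 1) (1 : DirichletCharacter ℂ 1) hx y
  rw [DirichletCharacter.LFunctionTrivChar] at this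
  simp only [DirichletCharacter.LFunction_modOne_eq] at this
  simpa [norm_mul, norm_pow] using this

lemma zeta_lower : ∃ C > 0, ∀ s : ℂ, 1 < s.re → s.re ≤ 2 → 1 ≤ |s.im| →
    1 ≤ C * (|s.im| ^ (1 / 30 : ℝ)) ^ 4 * ‖riemannZeta s‖ := by
  obtain ⟨A, hA, hA'⟩ := zeta_near_one
  obtain ⟨D, hD, hD'⟩ := zeta_iter_bound
  set K := A ^ 3 * (D * 2) with hK
  have hK0 : 0 < K := by positivity
  have stepA : ∀ x y : ℝ, 0 < x → x ≤ 1 → 1 ≤ |y| →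
      x ^ 3 ≤ K * |y| ^ (1 / 30 : ℝ) * ‖riemannZeta (1 + x + I * y)‖ ^ 4 := by
    intro x y hx hx1 hy
    have h1 := zeta_341 x hx y
    have h2 := hA' x hx hx1
    have h3 := hD' (1 + x + 2 * I * y) (by simp; linarith) (by simp; linarith)
      (by simp [abs_mul]; linarith) 0 (by norm_num)
    have h4 : |(1 + x + 2 * I * y : ℂ).im| ^ (1 / 30 : ℝ) ≤ 2 * |y| ^ (1 / 30 : ℝ) := by
      have : |(1 + x + 2 * I * y : ℂ).im| = 2 * |y| := by simp [abs_mul]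
      rw [this, Real.mul_rpow (by norm_num) (by positivity)]
      gcongr
      calc (2 : ℝ) ^ (1 / 30 : ℝ) ≤ 2 ^ (1 : ℝ) := Real.rpow_le_rpow_of_exponent_le (by norm_num) (by norm_num)
          _ = 2 := by norm_num
    rw [iteratedDeriv_zero] at h3
    have h5 : 1 ≤ (A / x) ^ 3 * ‖riemannZeta (1 + x + I * y)‖ ^ 4 * (D * (2 * |y| ^ (1 / 30 : ℝ))) := by
      refine h1.trans ?_
      gcongr
      exact h3.trans (by gcongr)
    have h6 : (A / x) ^ 3 * ‖riemannZeta (1 + x + I * y)‖ ^ 4 * (D * (2 * |y| ^ (1 / 30 : ℝ))) =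
        (K * |y| ^ (1 / 30 : ℝ) * ‖riemannZeta (1 + x + I * y)‖ ^ 4) / x ^ 3 := by
      rw [hK]; field_simp
    rw [h6, le_div_iff₀ (by positivity)] at h5
    linarith
  set a := min 1 (1 / (16 * D ^ 4 * K)) with ha
  have ha0 : 0 < a := by positivity
  have ha1 : a ≤ 1 := min_le_left _ _
  have ha2 : 16 * D ^ 4 * K * a ≤ 1 := by
    have : a ≤ 1 / (16 * D ^ 4 * K) := min_le_right _ _
    rw [le_div_iff₀ (by positivity)] at this; linarith
  have stepB : ∀ x y : ℝ, 0 < x → x ≤ 1 → 1 ≤ |y| → a ≤ x * (|y| ^ (1 / 30 : ℝ)) ^ 5 →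
      2 * D * a ≤ (|y| ^ (1 / 30 : ℝ)) ^ 4 * ‖riemannZeta (1 + x + I * y)‖ := by
    intro x y hx hx1 hy hax
    have h1 := stepA x y hx hx1 hy
    set W := |y| ^ (1 / 30 : ℝ) with hW
    have hW1 : 1 ≤ W := Real.one_le_rpow hy (by norm_num)
    set z := ‖riemannZeta (1 + x + I * y)‖
    have h2 : a ^ 3 ≤ K * (W ^ 4 * z) ^ 4 := by
      calc a ^ 3 ≤ (x * W ^ 5) ^ 3 := by gcongr
        _ = x ^ 3 * W ^ 15 := by ring
        _ ≤ (K * W * z ^ 4) * W ^ 15 := by gcongr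
        _ = _ := by ring
    apply le_of_pow_le_pow_left₀ (n := 4) (by norm_num) (by positivity)
    have h3 : K * (2 * D * a) ^ 4 ≤ a ^ 3 := by
      calc K * (2 * D * a) ^ 4 = (16 * D ^ 4 * K * a) * a ^ 3 := by ring
        _ ≤ 1 * a ^ 3 := by gcongr
        _ = _ := by ring
    exact le_of_mul_le_mul_left (h3.trans h2) hK0
  refine ⟨1 / (D * a), by positivity, ?_⟩
  intro s h1 h2 h3
  set W := |s.im| ^ (1 / 30 : ℝ) with hW
  have hW1 : 1 ≤ W := Real.one_le_rpow h3 (by norm_num)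
  suffices h : D * a ≤ W ^ 4 * ‖riemannZeta s‖ by
    rw [mul_assoc, div_mul_eq_mul_div, le_div_iff₀ (by positivity)]; linarith
  have hs : s = 1 + ((s.re - 1 : ℝ) : ℂ) + I * (s.im : ℂ) := by
    apply Complex.ext <;> simp
  by_cases hc : a ≤ (s.re - 1) * W ^ 5
  · have := stepB (s.re - 1) s.im (by linarith) (by linarith) h3 hc
    rw [← hs] at this
    have : 0 < D * a := by positivity
    linarith
  · push Not at hc
    set η := a / W ^ 5 with hη
    have hη0 : 0 < η := by positivity
    have hηa : η * W ^ 5 = a := by rw [hη]; field_simp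
    have hη1 : η ≤ 1 := by
      rw [hη, div_le_one (by positivity)]
      exact ha1.trans (one_le_pow₀ hW1)
    have hlt : s.re - 1 < η := by rw [hη, lt_div_iff₀ (by positivity)]; exact hc
    have hB := stepB η s.im hη0 hη1 h3 hηa.ge
    set s0 : ℂ := 1 + η + I * s.im with hs0
    let V : Set ℂ := {z | 1 < z.re ∧ z.re ≤ 2 ∧ z.im = s.im}
    have hV : Convex ℝ V := by
      have e : V = (Complex.reLm ⁻¹' (Set.Ioc 1 2)) ∩ (Complex.imLm ⁻¹' {s.im}) := by
        ext z; simp [V, and_assoc]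
      rw [e]
      exact ((convex_Ioc _ _).linear_preimage _).inter ((convex_singleton _).linear_preimage _)
    have hm := hV.norm_image_sub_le_of_norm_deriv_le (f := riemannZeta) (C := D * W)
      (fun z hz => differentiableAt_riemannZeta (by rintro rfl; simp [V] at hz))
      (fun z hz => by
        have := hD' z hz.1 hz.2.1 (by rw [hz.2.2]; exact h3) 1 (by norm_num)
        rw [iteratedDeriv_one, hz.2.2] at this; exact this)
      (show s ∈ V from ⟨h1, h2, rfl⟩)
      (show s0 ∈ V from ⟨by simp [hs0, hη0], by simp [hs0]; linarith, by simp [hs0]⟩)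
    have hd : ‖s0 - s‖ ≤ η := by
      have : s0 - s = ((η - (s.re - 1) : ℝ) : ℂ) := by
        rw [hs0]; apply Complex.ext <;> simp; ring
      rw [this, Complex.norm_of_nonneg (by linarith)]; linarith
    have h6 : ‖riemannZeta s0‖ - ‖riemannZeta s‖ ≤ D * W * η := by
      calc _ ≤ ‖riemannZeta s0 - riemannZeta s‖ := norm_sub_norm_le _ _
        _ ≤ _ := hm.trans (by gcongr)
    have h7 : W ^ 4 * (‖riemannZeta s0‖ - ‖riemannZeta s‖) ≤ W ^ 4 * (D * W * η) := by gcongr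
    have h8 : W ^ 4 * (D * W * η) = D * a := by rw [← hηa]; ring
    linarith

lemma analyticAt_iter {f : ℂ → ℂ} {s : ℂ} (h : AnalyticAt ℂ f s) (j : ℕ) :
    AnalyticAt ℂ (iteratedDeriv j f) s := by
  rw [iteratedDeriv_eq_iterate]; exact h.iterated_deriv j

lemma zeta_hasDeriv (j : ℕ) (s : ℂ) (hs : s ≠ 1) :
    HasDerivAt (iteratedDeriv j riemannZeta) (iteratedDeriv (j + 1) riemannZeta s) s := by
  have h : AnalyticAt ℂ riemannZeta s := by
    have : DifferentiableOn ℂ riemannZeta {1}ᶜ := fun z hz =>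
      (differentiableAt_riemannZeta hz).differentiableWithinAt
    exact this.analyticAt (isOpen_compl_singleton.mem_nhds hs)
  rw [iteratedDeriv_succ]
  exact (analyticAt_iter h j).differentiableAt.hasDerivAt

noncomputable def Fz (s : ℂ) : ℂ := - deriv riemannZeta s / riemannZeta s - riemannZeta s

lemma Fz_iter (s : ℂ) (hs : 1 < s.re) : iteratedDeriv 2 Fz s =
    -(iteratedDeriv 3 riemannZeta s / riemannZeta s
      - 3 * iteratedDeriv 1 riemannZeta s * iteratedDeriv 2 riemannZeta s / riemannZeta s ^ 2
      + 2 * iteratedDeriv 1 riemannZeta s ^ 3 / riemannZeta s ^ 3) - iteratedDeriv 2 riemannZeta s := by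
  have hne : ∀ z : ℂ, 1 < z.re → z ≠ 1 := by rintro z hz rfl; simp at hz
  have h0 : ∀ z : ℂ, 1 < z.re → riemannZeta z ≠ 0 := fun z hz => riemannZeta_ne_zero_of_one_lt_re hz
  have d0 : ∀ z : ℂ, 1 < z.re → HasDerivAt riemannZeta (iteratedDeriv 1 riemannZeta z) z := by
    intro z hz; simpa using zeta_hasDeriv 0 z (hne z hz)
  have e1 : deriv Fz =ᶠ[nhds s] fun z => -(iteratedDeriv 2 riemannZeta z * riemannZeta z
      - iteratedDeriv 1 riemannZeta z ^ 2) / riemannZeta z ^ 2 - iteratedDeriv 1 riemannZeta z := by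
    filter_upwards [(isOpen_lt continuous_const continuous_re).mem_nhds hs] with z hz
    have := (((zeta_hasDeriv 1 z (hne z hz)).neg).div (d0 z hz) (h0 z hz)).sub (d0 z hz)
    have h2 := this.congr_of_eventuallyEq (f₁ := Fz) (Filter.Eventually.of_forall fun w => by
      simp [Fz, iteratedDeriv_one])
    rw [h2.deriv]; simp only [Pi.neg_apply]; ring
  rw [iteratedDeriv_succ, iteratedDeriv_one, e1.deriv_eq]
  have z0 := h0 s hs
  have := ((((((zeta_hasDeriv 2 s (hne s hs)).mul (d0 s hs)).sub
    ((zeta_hasDeriv 1 s (hne s hs)).pow 2)).neg).div ((d0 s hs).pow 2) (pow_ne_zero 2 z0))).sub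
      (zeta_hasDeriv 1 s (hne s hs))
  have h2 := this.deriv
  refine Eq.trans ?_ (h2.trans ?_)
  · rfl
  · simp only [Pi.neg_apply, Pi.sub_apply, Pi.mul_apply, Pi.pow_apply]
    field_simp
    ring

lemma Fz_bound_large : ∃ C > 0, ∀ s : ℂ, 1 < s.re → s.re ≤ 2 → 1 ≤ |s.im| →
    ‖iteratedDeriv 2 Fz s‖ ≤ C * |s.im| ^ (1 / 2 : ℝ) := by
  obtain ⟨A, hA, hA'⟩ := zeta_lower
  obtain ⟨D, hD, hD'⟩ := zeta_iter_bound
  refine ⟨D * A + 3 * D * D * A ^ 2 + 2 * D ^ 3 * A ^ 3 + D, by positivity, ?_⟩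
  intro s h1 h2 h3
  rw [Fz_iter s h1]
  have hl := hA' s h1 h2 h3
  have b1 := hD' s h1 h2 h3 1 (by norm_num)
  have b2 := hD' s h1 h2 h3 2 (by norm_num)
  have b3 := hD' s h1 h2 h3 3 (by norm_num)
  have hW15 : |s.im| ^ (1 / 2 : ℝ) = (|s.im| ^ (1 / 30 : ℝ)) ^ 15 := by
    rw [← Real.rpow_natCast, ← Real.rpow_mul (abs_nonneg _)]; norm_num
  rw [hW15]
  set W := |s.im| ^ (1 / 30 : ℝ) with hW
  have hW1 : 1 ≤ W := Real.one_le_rpow h3 (by norm_num)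
  have z0 : riemannZeta s ≠ 0 := riemannZeta_ne_zero_of_one_lt_re h1
  have hz : 0 < ‖riemannZeta s‖ := norm_pos_iff.mpr z0
  have hi : ‖riemannZeta s‖⁻¹ ≤ A * W ^ 4 := by
    rw [inv_le_iff_one_le_mul₀ hz]; exact hl
  set i := ‖riemannZeta s‖⁻¹ with hi'
  have hi0 : 0 < i := by positivity
  have p1 : W ^ 5 ≤ W ^ 15 := pow_le_pow_right₀ hW1 (by norm_num)
  have p2 : W ^ 10 ≤ W ^ 15 := pow_le_pow_right₀ hW1 (by norm_num)
  have p3 : W ≤ W ^ 15 := le_self_pow₀ hW1 (by norm_num)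
  have t1 : ‖iteratedDeriv 3 riemannZeta s / riemannZeta s‖ ≤ D * A * W ^ 15 := by
    rw [norm_div, div_eq_mul_inv]
    calc _ ≤ (D * W) * (A * W ^ 4) := by gcongr
      _ = D * A * W ^ 5 := by ring
      _ ≤ _ := by gcongr
  have t2 : ‖3 * iteratedDeriv 1 riemannZeta s * iteratedDeriv 2 riemannZeta s / riemannZeta s ^ 2‖
      ≤ 3 * D * D * A ^ 2 * W ^ 15 := by
    rw [norm_div, div_eq_mul_inv, norm_mul, norm_mul, norm_pow, ← inv_pow]
    calc _ ≤ 3 * (D * W) * (D * W) * (A * W ^ 4) ^ 2 := by gcongr; simp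
      _ = 3 * D * D * A ^ 2 * W ^ 10 := by ring
      _ ≤ _ := by gcongr
  have t3 : ‖2 * iteratedDeriv 1 riemannZeta s ^ 3 / riemannZeta s ^ 3‖
      ≤ 2 * D ^ 3 * A ^ 3 * W ^ 15 := by
    rw [norm_div, div_eq_mul_inv, norm_mul, norm_pow, norm_pow, ← inv_pow]
    calc _ ≤ 2 * (D * W) ^ 3 * (A * W ^ 4) ^ 3 := by gcongr; simp
      _ = _ := by ring
  have t4 : ‖iteratedDeriv 2 riemannZeta s‖ ≤ D * W ^ 15 := b2.trans (by gcongr)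
  calc _ ≤ (‖iteratedDeriv 3 riemannZeta s / riemannZeta s‖ +
      ‖3 * iteratedDeriv 1 riemannZeta s * iteratedDeriv 2 riemannZeta s / riemannZeta s ^ 2‖ +
      ‖2 * iteratedDeriv 1 riemannZeta s ^ 3 / riemannZeta s ^ 3‖) + ‖iteratedDeriv 2 riemannZeta s‖ := by
        refine (norm_sub_le _ _).trans ?_
        rw [norm_neg]
        gcongr
        refine (norm_add_le _ _).trans ?_
        gcongr
        exact norm_sub_le _ _
    _ ≤ _ := by linarith

noncomputable def Zz : ℂ → ℂ := Function.update (fun s => (s - 1) * riemannZeta s) 1 1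

lemma Zz_ne (s : ℂ) (hs : s ≠ 1) : Zz s = (s - 1) * riemannZeta s := by
  rw [Zz, Function.update_of_ne hs]

lemma Zz_one : Zz 1 = 1 := by simp [Zz]

lemma Zz_diff : Differentiable ℂ Zz := by
  have hd : ∀ s, s ≠ 1 → DifferentiableAt ℂ Zz s := by
    intro s hs
    have : Zz =ᶠ[nhds s] fun s => (s - 1) * riemannZeta s := by
      filter_upwards [isOpen_compl_singleton.mem_nhds hs] with z hz
      exact Zz_ne z hz
    exact DifferentiableAt.congr_of_eventuallyEq
      ((by fun_prop : DifferentiableAt ℂ (fun s : ℂ => s - 1) s).mul (differentiableAt_riemannZeta hs)) this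
  intro s
  by_cases hs : s = 1
  · subst hs
    refine (Complex.analyticAt_of_differentiable_on_punctured_nhds_of_continuousAt ?_ ?_).differentiableAt
    · filter_upwards [self_mem_nhdsWithin] with z hz using hd z hz
    · rw [Zz, continuousAt_update_same]; exact riemannZeta_residue_one
  · exact hd s hs

lemma Fz_bound_small : ∃ C > 0, ∀ s : ℂ, 1 < s.re → s.re ≤ 2 → |s.im| ≤ 1 →
    ‖iteratedDeriv 2 Fz s‖ ≤ C := by
  let Ft : ℂ → ℂ := fun s => - deriv Zz s / Zz s - dslope Zz 1 s
  have hds : Differentiable ℂ (dslope Zz 1) := by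
    rw [← differentiableOn_univ, Complex.differentiableOn_dslope Filter.univ_mem]
    exact Zz_diff.differentiableOn
  have hdd : Differentiable ℂ (deriv Zz) := by
    intro s
    exact ((Zz_diff.analyticAt s).deriv).differentiableAt
  let B : Set ℂ := {s | 1 ≤ s.re} ∩ {s | s.re ≤ 2} ∩ {s | |s.im| ≤ 1}
  have hB : IsCompact B := by
    apply Metric.isCompact_of_isClosed_isBounded
    · exact ((isClosed_le continuous_const continuous_re).inter
        (isClosed_le continuous_re continuous_const)).inter
        (isClosed_le (continuous_abs.comp continuous_im) continuous_const)
    · refine (Metric.isBounded_closedBall (x := (0 : ℂ)) (r := 3)).subset ?_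
      intro s hs
      have h1 : 1 ≤ s.re := hs.1.1
      have h2 : s.re ≤ 2 := hs.1.2
      have h3 : |s.im| ≤ 1 := hs.2
      have := Complex.norm_le_abs_re_add_abs_im s
      rw [abs_of_pos (by linarith)] at this
      simp; linarith
  have hnz : ∀ s ∈ B, Zz s ≠ 0 := by
    intro s hs
    by_cases h : s = 1
    · rw [h, Zz_one]; exact one_ne_zero
    · rw [Zz_ne s h]
      exact mul_ne_zero (sub_ne_zero.mpr h) (riemannZeta_ne_zero_of_one_le_re hs.1.1)
  let V : Set ℂ := {s | Zz s ≠ 0}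
  have hV : IsOpen V := isOpen_ne_fun Zz_diff.continuous continuous_const
  have hFt : DifferentiableOn ℂ Ft V := by
    intro s hs
    exact (((hdd s).neg.div (Zz_diff s) hs).sub (hds s)).differentiableWithinAt
  have hcont : ContinuousOn (iteratedDeriv 2 Ft) B := by
    intro s hs
    have := analyticAt_iter (hFt.analyticAt (hV.mem_nhds (hnz s hs))) 2
    exact this.continuousAt.continuousWithinAt
  obtain ⟨C, hC⟩ := hB.exists_bound_of_continuousOn hcont
  refine ⟨max C 1, by positivity, ?_⟩
  intro s h1 h2 h3
  have heq : Fz =ᶠ[nhds s] Ft := by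
    filter_upwards [(isOpen_lt continuous_const continuous_re).mem_nhds h1] with z hz
    have hne : z ≠ 1 := by rintro rfl; simp at hz
    have hz1 : z - 1 ≠ 0 := sub_ne_zero.mpr hne
    have hz0 : riemannZeta z ≠ 0 := riemannZeta_ne_zero_of_one_lt_re hz
    have hdz : deriv Zz z = riemannZeta z + (z - 1) * deriv riemannZeta z := by
      have : Zz =ᶠ[nhds z] fun s => (s - 1) * riemannZeta s := by
        filter_upwards [isOpen_compl_singleton.mem_nhds hne] with w hw
        exact Zz_ne w hw
      rw [this.deriv_eq]
      have h := ((hasDerivAt_id z).sub_const 1).mul (differentiableAt_riemannZeta hne).hasDerivAt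
      have := h.deriv
      simp only [id, one_mul] at this
      exact this
    simp only [Fz, Ft]
    rw [hdz, dslope_of_ne _ hne, slope_def_field, Zz_one, Zz_ne z hne]
    field_simp
    ring
  rw [heq.iteratedDeriv_eq]
  exact (hC s ⟨⟨h1.le, h2⟩, h3⟩).trans (le_max_left _ _)

lemma Fz_bound : ∃ C > 0, ∀ s : ℂ, 1 < s.re → s.re ≤ 2 →
    ‖iteratedDeriv 2 Fz s‖ ≤ C * (1 + |s.im|) ^ (1 / 2 : ℝ) := by
  obtain ⟨A, hA, hA'⟩ := Fz_bound_large
  obtain ⟨D, hD, hD'⟩ := Fz_bound_small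
  refine ⟨A + D, by positivity, ?_⟩
  intro s h1 h2
  have p : 1 ≤ (1 + |s.im|) ^ (1 / 2 : ℝ) := Real.one_le_rpow (by linarith [abs_nonneg s.im]) (by norm_num)
  rcases le_total 1 |s.im| with h | h
  · refine (hA' s h1 h2 h).trans ?_
    calc _ ≤ A * (1 + |s.im|) ^ (1 / 2 : ℝ) := by gcongr; linarith
      _ ≤ _ := by gcongr; linarith
  · refine (hD' s h1 h2 h).trans ?_
    nlinarith

open ArithmeticFunction in
/-- coefficients -/
noncomputable def bz (n : ℕ) : ℝ := Real.log n ^ 2 * (Λ n - 1)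

open ArithmeticFunction LSeries in
lemma bz_facts : (∀ s : ℂ, 1 < s.re → LSeriesSummable (fun n => (bz n : ℂ)) s) ∧
    ∀ s : ℂ, 1 < s.re → LSeries (fun n => (bz n : ℂ)) s = iteratedDeriv 2 Fz s := by
  let a : ℕ → ℂ := (fun n => (Λ n : ℂ)) - 1
  have hs : ∀ s : ℂ, 1 < s.re → LSeriesSummable a s := fun s hs =>
    (LSeriesSummable_vonMangoldt hs).sub (LSeriesSummable_one_iff.mpr hs)
  have hab : abscissaOfAbsConv a ≤ 1 :=
    abscissaOfAbsConv_le_of_forall_lt_LSeriesSummable fun y hy => hs y (by simpa using hy)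
  have hlt : ∀ s : ℂ, 1 < s.re → abscissaOfAbsConv a < s.re := fun s hs =>
    hab.trans_lt (by exact_mod_cast hs)
  have e : (fun n => (bz n : ℂ)) = logMul^[2] a := by
    ext n
    simp only [bz, Function.iterate_succ, Function.iterate_zero, Function.comp, id, logMul, a]
    push_cast [← Complex.natCast_log]
    simp [Complex.natCast_log]
    ring
  rw [e]
  constructor
  · intro s h
    exact LSeriesSummable_of_abscissaOfAbsConv_lt_re (by rw [absicssaOfAbsConv_logPowMul]; exact hlt s h)
  · intro s h
    have h1 := LSeries_iteratedDeriv (f := a) 2 (hlt s h)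
    have h2 : LSeries a =ᶠ[nhds s] Fz := by
      filter_upwards [(isOpen_lt continuous_const continuous_re).mem_nhds h] with z hz
      rw [show a = (fun n => (Λ n : ℂ)) - 1 from rfl,
        LSeries_sub (LSeriesSummable_vonMangoldt hz) (LSeriesSummable_one_iff.mpr hz),
        LSeries_vonMangoldt_eq_deriv_riemannZeta_div hz, LSeries_one_eq_riemannZeta hz, Fz]
    rw [← h2.iteratedDeriv_eq, h1]; simp

end

section
open Complex MeasureTheory

noncomputable def wz (t : ℝ) : ℂ := Set.indicator (Set.Ioc 0 1) (fun _ => (1 : ℂ)) t -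
  Set.indicator (Set.Ioc 0 1) (fun t : ℝ => (t : ℂ) ^ (1 : ℂ)) t

lemma wz_mellin (s : ℂ) (hs : 0 < s.re) : HasMellin wz s (1 / s - 1 / (s + 1)) := by
  have h1 := hasMellin_one_Ioc hs
  have h2 := hasMellin_cpow_Ioc 1 (s := s) (by simp; linarith)
  have := hasMellin_sub h1.1 h2.1
  rw [h1.2, h2.2] at this
  exact this

lemma wz_eq (t : ℝ) (ht : 0 < t) : wz t = ((max 0 (1 - t) : ℝ) : ℂ) := by
  unfold wz
  by_cases h : t ≤ 1
  · have hm : t ∈ Set.Ioc (0 : ℝ) 1 := ⟨ht, h⟩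
    rw [Set.indicator_of_mem hm, Set.indicator_of_mem hm, max_eq_right (by linarith)]
    simp
  · have hm : t ∉ Set.Ioc (0 : ℝ) 1 := fun h' => h h'.2
    rw [Set.indicator_of_notMem hm, Set.indicator_of_notMem hm, max_eq_left (by linarith)]
    simp

noncomputable def kz (σ : ℝ) (y : ℝ) : ℂ := 1 / (σ + y * I) - 1 / (σ + y * I + 1)

lemma kz_bound (σ : ℝ) (hσ : 1 < σ) (y : ℝ) : ‖kz σ y‖ ≤ 4 * (1 + |y|) ^ (-2 : ℝ) := by
  have e1 : ∀ z : ℂ, 1 ≤ z.re → (1 + |z.im|) / 2 ≤ ‖z‖ := by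
    intro z hz
    have h1 := Complex.abs_re_le_norm z
    have h2 := Complex.abs_im_le_norm z
    have := le_abs_self z.re
    linarith
  have h1 := e1 (σ + y * I) (by simp; linarith)
  have h2 := e1 (σ + y * I + 1) (by simp; linarith)
  simp only [add_im, ofReal_im, mul_im, ofReal_re, I_im, mul_one, I_re, mul_zero, add_zero, zero_add, one_im] at h1 h2
  have hp : 0 < (1 + |y|) / 2 := by positivity
  have n1 : (σ + y * I : ℂ) ≠ 0 := norm_pos_iff.mp (by linarith)
  have n2 : (σ + y * I + 1 : ℂ) ≠ 0 := norm_pos_iff.mp (by linarith)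
  have : kz σ y = 1 / ((σ + y * I) * (σ + y * I + 1)) := by
    unfold kz; field_simp; ring
  rw [this, norm_div, norm_one, norm_mul, Real.rpow_neg (by positivity)]
  rw [show (2 : ℝ) = ((2 : ℕ) : ℝ) by norm_num, Real.rpow_natCast, ← div_eq_mul_inv,
    div_le_div_iff₀ (by nlinarith) (by positivity)]
  have := mul_le_mul h1 h2 hp.le (norm_nonneg _)
  nlinarith

lemma kz_cont (σ : ℝ) (hσ : 1 < σ) : Continuous (kz σ) := by
  have n1 : ∀ y : ℝ, (σ + y * I : ℂ) ≠ 0 := by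
    intro y h
    have := congrArg Complex.re h
    simp at this; linarith
  have n2 : ∀ y : ℝ, (σ + y * I + 1 : ℂ) ≠ 0 := by
    intro y h
    have := congrArg Complex.re h
    simp at this; linarith
  unfold kz
  fun_prop (disch := first | exact n1 _ | exact n2 _ | assumption)

lemma int_pow (r : ℝ) (hr : 1 < r) : Integrable (fun y : ℝ => (1 + |y|) ^ (-r)) := by
  have := integrable_one_add_norm (E := ℝ) (μ := volume) (r := r) (by simpa using hr)
  simpa using this

lemma kz_int (σ : ℝ) (hσ : 1 < σ) : Integrable (kz σ) := by
  refine Integrable.mono' ((int_pow 2 (by norm_num)).const_mul 4) (kz_cont σ hσ).aestronglyMeasurable ?_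
  exact Filter.Eventually.of_forall (kz_bound σ hσ)

lemma wz_inv (σ : ℝ) (hσ : 1 < σ) (t : ℝ) (ht : 0 < t) :
    ∫ y : ℝ, (t : ℂ) ^ (-(σ + y * I : ℂ)) * kz σ y = 2 * Real.pi * ((max 0 (1 - t) : ℝ) : ℂ) := by
  have hm : ∀ y : ℝ, mellin wz (σ + y * I) = kz σ y := fun y =>
    (wz_mellin _ (by simp; linarith)).2
  have hc : ContinuousAt wz t := by
    have : wz =ᶠ[nhds t] fun t => ((max 0 (1 - t) : ℝ) : ℂ) := by
      filter_upwards [lt_mem_nhds ht] with u hu using wz_eq u hu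
    refine ContinuousAt.congr ?_ this.symm
    fun_prop
  have hi : VerticalIntegrable (mellin wz) σ := by
    unfold VerticalIntegrable
    simp_rw [hm]; exact kz_int σ hσ
  have := mellinInv_mellin_eq σ wz ht (wz_mellin σ (by simp; linarith)).1 hi hc
  rw [mellinInv, wz_eq t ht] at this
  simp_rw [hm, smul_eq_mul] at this
  rw [← this]
  have : (Real.pi : ℂ) ≠ 0 := by exact_mod_cast Real.pi_ne_zero
  simp only [real_smul]
  generalize (∫ y : ℝ, (t : ℂ) ^ (-(σ + y * I : ℂ)) * kz σ y) = Q
  push_cast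
  field_simp

lemma perron_bound (b : ℕ → ℂ) (σ : ℝ) (hσ : 1 < σ) (hb : LSeriesSummable b σ) (N : ℕ) (hN : 1 ≤ N)
    (C : ℝ) (hC : 0 ≤ C) (hL : ∀ y : ℝ, ‖LSeries b (σ + y * I)‖ ≤ C * (1 + |y|) ^ (1 / 2 : ℝ)) :
    2 * Real.pi * ‖∑ n ∈ Finset.Icc 1 N, b n * ((1 - n / N : ℝ) : ℂ)‖ ≤
      (N : ℝ) ^ σ * C * 4 * ∫ y : ℝ, (1 + |y|) ^ (-(3 / 2) : ℝ) := by
  have hN0 : (0 : ℝ) < N := by exact_mod_cast hN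
  let F : ℕ → ℝ → ℂ := fun n y => LSeries.term b (σ + y * I) n * ((N : ℂ) ^ (σ + y * I : ℂ) * kz σ y)
  have hnormN : ∀ y : ℝ, ‖(N : ℂ) ^ (σ + y * I : ℂ)‖ = (N : ℝ) ^ σ := by
    intro y
    have := norm_cpow_eq_rpow_re_of_pos hN0 (σ + y * I)
    simpa using this
  have hcN : Continuous fun y : ℝ => (N : ℂ) ^ (σ + y * I : ℂ) := by
    have : (N : ℂ) ≠ 0 := by exact_mod_cast hN0.ne'
    exact Continuous.const_cpow (by fun_prop) (Or.inl this)
  have hterm : ∀ n (y : ℝ), ‖LSeries.term b (σ + y * I) n‖ = ‖LSeries.term b σ n‖ := by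
    intro n y
    rw [LSeries.norm_term_eq, LSeries.norm_term_eq]; simp
  have hFn : ∀ n y, ‖F n y‖ = ‖LSeries.term b σ n‖ * ((N : ℝ) ^ σ * ‖kz σ y‖) := by
    intro n y
    simp only [F]; rw [norm_mul, norm_mul, hterm, hnormN]
  have hFc : ∀ n, Continuous (F n) := by
    intro n
    have : Continuous fun y : ℝ => LSeries.term b (σ + y * I) n := by
      rcases eq_or_ne n 0 with rfl | hn
      · simp only [LSeries.term_zero]; exact continuous_const
      · simp only [LSeries.term_of_ne_zero hn]
        have h : (n : ℂ) ≠ 0 := by exact_mod_cast hn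
        have h2 : ∀ y : ℝ, (n : ℂ) ^ (σ + y * I : ℂ) ≠ 0 := fun y => by simp [cpow_eq_zero_iff, h]
        refine Continuous.div continuous_const ?_ h2
        exact Continuous.const_cpow (by fun_prop) (Or.inl h)
    exact this.mul (hcN.mul (kz_cont σ hσ))
  have hFi : ∀ n, Integrable (F n) := by
    intro n
    refine Integrable.mono' (((kz_int σ hσ).norm.const_mul ((N : ℝ) ^ σ)).const_mul ‖LSeries.term b σ n‖)
      (hFc n).aestronglyMeasurable ?_
    exact Filter.Eventually.of_forall fun y => (hFn n y).le
  have hsum := hasSum_integral_of_summable_integral_norm hFi (by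
    simp_rw [hFn, integral_const_mul]
    exact (Summable.norm hb).mul_right _)
  have hint : ∀ n, ∫ y, F n y = if n = 0 then 0 else
      2 * Real.pi * (b n * ((max 0 (1 - n / N) : ℝ) : ℂ)) := by
    intro n
    split_ifs with hn
    · subst hn; simp [F]
    · have hn0 : (0 : ℝ) < n := by exact_mod_cast Nat.pos_of_ne_zero hn
      have e : ∀ y, F n y = b n * (((n / N : ℝ) : ℂ) ^ (-(σ + y * I : ℂ)) * kz σ y) := by
        intro y
        simp only [F]
        rw [LSeries.term_of_ne_zero hn, div_eq_mul_inv (n : ℝ), ofReal_mul,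
          mul_cpow_ofReal_nonneg hn0.le (by positivity), cpow_neg, cpow_neg, ofReal_inv, inv_cpow, inv_inv]
        · push_cast; ring
        · rw [ofReal_natCast, natCast_arg]; exact Real.pi_pos.ne
      simp_rw [e]
      rw [integral_const_mul, wz_inv σ hσ _ (by positivity)]
      ring
  have hlhs : ∑' n, ∫ y, F n y = 2 * Real.pi * ∑ n ∈ Finset.Icc 1 N, b n * ((1 - n / N : ℝ) : ℂ) := by
    rw [tsum_eq_sum (s := Finset.Icc 1 N), Finset.mul_sum]
    · refine Finset.sum_congr rfl fun n hn => ?_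
      rw [Finset.mem_Icc] at hn
      rw [hint, if_neg (by omega), max_eq_right]
      have : (n : ℝ) ≤ N := by exact_mod_cast hn.2
      rw [sub_nonneg, div_le_one hN0]; exact this
    · intro n hn
      rw [hint]
      split_ifs with h0
      · rfl
      · have h : N < n := by
          by_contra hc; exact hn (Finset.mem_Icc.mpr ⟨by omega, by omega⟩)
        have : (N : ℝ) < n := by exact_mod_cast h
        rw [max_eq_left]
        · simp
        · rw [sub_nonpos, one_le_div hN0]; exact this.le
  have hfin : ‖∑' n, ∫ y, F n y‖ ≤ ∫ y : ℝ, (N : ℝ) ^ σ * C * 4 * (1 + |y|) ^ (-(3 / 2) : ℝ) := by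
    rw [hsum.tsum_eq]
    refine norm_integral_le_of_norm_le ((int_pow (3 / 2) (by norm_num)).const_mul _) ?_
    refine Filter.Eventually.of_forall fun y => ?_
    have : ∑' n, F n y = LSeries b (σ + y * I) * ((N : ℂ) ^ (σ + y * I : ℂ) * kz σ y) := by
      simp only [F]; rw [tsum_mul_right]; rfl
    rw [this, norm_mul, norm_mul, hnormN]
    calc _ ≤ (C * (1 + |y|) ^ (1 / 2 : ℝ)) * ((N : ℝ) ^ σ * (4 * (1 + |y|) ^ (-2 : ℝ))) := by
          gcongr
          · exact hL y
          · exact kz_bound σ hσ y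
      _ = (N : ℝ) ^ σ * C * 4 * ((1 + |y|) ^ (1 / 2 : ℝ) * (1 + |y|) ^ (-2 : ℝ)) := by ring
      _ = _ := by rw [← Real.rpow_add (by positivity)]; norm_num
  rw [hlhs, integral_const_mul, norm_mul] at hfin
  simpa [abs_of_pos Real.pi_pos] using hfin

lemma bz_smooth : ∃ C > 0, ∀ N : ℕ, |∑ n ∈ Finset.Icc 1 N, bz n * (N - n)| ≤ C * (N : ℝ) ^ 2 := by
  obtain ⟨C, hC, hb⟩ := Fz_bound
  obtain ⟨hs, hL⟩ := bz_facts
  set J := ∫ y : ℝ, (1 + |y|) ^ (-(3 / 2) : ℝ) with hJ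
  have hJ0 : 0 ≤ J := integral_nonneg fun y => by positivity
  set A := ∑ N ∈ Finset.range 3, |∑ n ∈ Finset.Icc 1 N, bz n * ((N : ℝ) - n)| with hA
  have hA0 : 0 ≤ A := Finset.sum_nonneg fun _ _ => abs_nonneg _
  refine ⟨Real.exp 1 * C * 4 * J + A + 1, by positivity, ?_⟩
  intro N
  rcases Nat.eq_zero_or_pos N with rfl | hN
  · simp
  have hN1 : (1 : ℝ) ≤ N := by exact_mod_cast hN
  have hE : 0 ≤ Real.exp 1 * C * 4 * J := by positivity
  by_cases h3 : N < 3
  · have : |∑ n ∈ Finset.Icc 1 N, bz n * ((N : ℝ) - n)| ≤ A :=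
      Finset.single_le_sum (f := fun N : ℕ => |∑ n ∈ Finset.Icc 1 N, bz n * ((N : ℝ) - n)|)
        (fun _ _ => abs_nonneg _) (Finset.mem_range.mpr h3)
    have h2 : (1 : ℝ) ≤ (N : ℝ) ^ 2 := one_le_pow₀ hN1
    calc _ ≤ A := this
      _ ≤ (Real.exp 1 * C * 4 * J + A + 1) * 1 := by linarith
      _ ≤ _ := mul_le_mul_of_nonneg_left h2 (by linarith)
  · have hN3 : (3 : ℝ) ≤ N := by exact_mod_cast (by omega : 3 ≤ N)
    have hlog : 1 ≤ Real.log N := by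
      rw [Real.le_log_iff_exp_le (by linarith)]
      exact Real.exp_one_lt_d9.le.trans (by linarith)
    set σ := 1 + 1 / Real.log N with hσ
    have hσ1 : 1 < σ := by rw [hσ]; have : 0 < 1 / Real.log N := by positivity
                           linarith
    have hσ2 : σ ≤ 2 := by
      rw [hσ]; have : 1 / Real.log N ≤ 1 := by rw [div_le_one (by linarith)]; exact hlog
      linarith
    have hNσ : (N : ℝ) ^ σ = N * Real.exp 1 := by
      rw [hσ, Real.rpow_add (by linarith), Real.rpow_one, Real.rpow_def_of_pos (by linarith) (1 / Real.log N)]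
      congr 2; field_simp
    have := perron_bound (fun n => (bz n : ℂ)) σ hσ1 (hs σ (by simpa using hσ1)) N hN C hC.le (fun y => by
      rw [hL _ (by simpa using hσ1)]
      simpa using hb (σ + y * I) (by simpa using hσ1) (by simpa using hσ2))
    have e : ∑ n ∈ Finset.Icc 1 N, ((bz n : ℝ) : ℂ) * ((1 - n / N : ℝ) : ℂ) =
        ((∑ n ∈ Finset.Icc 1 N, bz n * (N - n) : ℝ) / N : ℝ) := by
      rw [Finset.sum_div]; push_cast
      refine Finset.sum_congr rfl fun n _ => ?_
      have : (N : ℂ) ≠ 0 := by exact_mod_cast (by omega : N ≠ 0)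
      field_simp
    rw [e, Complex.norm_real, Real.norm_eq_abs, abs_div, abs_of_pos (by linarith : (0 : ℝ) < N), hNσ] at this
    set X := |∑ n ∈ Finset.Icc 1 N, bz n * ((N : ℝ) - n)|
    have hX : 0 ≤ X := abs_nonneg _
    have hpi := Real.pi_gt_three
    have h1 : X / N ≤ 2 * Real.pi * (X / N) := by
      have : 0 ≤ X / N := by positivity
      nlinarith
    have h2 : X / N ≤ N * (Real.exp 1 * C * 4 * J) := by
      refine (h1.trans this).trans (le_of_eq ?_); ring
    rw [div_le_iff₀ (by linarith)] at h2
    nlinarith [sq_nonneg (N : ℝ)]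

end

section
open Finset ArithmeticFunction

noncomputable def Pz (m : ℕ) : ℝ := ∑ n ∈ Finset.Icc 1 m, Real.log n ^ 2 * vonMangoldt n
noncomputable def Qz (m : ℕ) : ℝ := ∑ n ∈ Finset.Icc 1 m, Real.log n ^ 2

lemma Pz_mono : Monotone Pz := by
  refine monotone_nat_of_le_succ fun n => ?_
  unfold Pz
  rw [Finset.sum_Icc_succ_top (by omega)]
  have : 0 ≤ Real.log ((n + 1 : ℕ) : ℝ) ^ 2 * vonMangoldt (n + 1) := mul_nonneg (sq_nonneg _) vonMangoldt_nonneg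
  linarith

lemma Qz_mono : Monotone Qz := by
  refine monotone_nat_of_le_succ fun n => ?_
  unfold Qz
  rw [Finset.sum_Icc_succ_top (by omega)]
  have : 0 ≤ Real.log ((n + 1 : ℕ) : ℝ) ^ 2 := (sq_nonneg _)
  linarith

lemma Qz_diff (N h M : ℕ) (hM : N + h ≤ M) : Qz (N + h) - Qz N ≤ h * Real.log M ^ 2 := by
  induction h with
  | zero => simp
  | succ h ih =>
    have := ih (by omega)
    have e : Qz (N + (h + 1)) = Qz (N + h) + Real.log ((N + h + 1 : ℕ) : ℝ) ^ 2 := by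
      unfold Qz
      rw [← add_assoc, Finset.sum_Icc_succ_top (by omega)]
    have l : Real.log ((N + h + 1 : ℕ) : ℝ) ^ 2 ≤ Real.log M ^ 2 := by
      refine pow_le_pow_left₀ (Real.log_natCast_nonneg _) (Real.log_le_log (by positivity) (by exact_mod_cast hM)) 2
    rw [e]; push_cast; push_cast at l; nlinarith

noncomputable def Ez (N : ℕ) : ℝ := ∑ n ∈ Finset.Icc 1 N, bz n * (N - n)

lemma Ez_succ (N : ℕ) : Ez (N + 1) = Ez N + (Pz N - Qz N) := by
  unfold Ez Pz Qz
  rw [Finset.sum_Icc_succ_top (by omega), ← Finset.sum_sub_distrib, ← Finset.sum_add_distrib]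
  simp only [sub_self, mul_zero, add_zero]
  refine Finset.sum_congr rfl fun n _ => ?_
  unfold bz; push_cast; ring

lemma Ez_diff (N h : ℕ) : h * (Pz N - Qz (N + h)) ≤ Ez (N + h) - Ez N ∧
    Ez (N + h) - Ez N ≤ h * (Pz (N + h) - Qz N) := by
  have key : ∀ j ≤ h, j * (Pz N - Qz (N + h)) ≤ Ez (N + j) - Ez N ∧
    Ez (N + j) - Ez N ≤ j * (Pz (N + h) - Qz N) := by
    intro j
    induction j with
    | zero => simp
    | succ j ih =>
      intro hj
      obtain ⟨h1, h2⟩ := ih (by omega)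
      rw [← add_assoc, Ez_succ]
      have a1 := Pz_mono (show N ≤ N + j by omega)
      have a2 := Pz_mono (show N + j ≤ N + h by omega)
      have a3 := Qz_mono (show N ≤ N + j by omega)
      have a4 := Qz_mono (show N + j ≤ N + h by omega)
      push_cast
      constructor <;> linarith
  exact key h le_rfl

lemma log_nat_ge_one {N : ℕ} (hN : 3 ≤ N) : 1 ≤ Real.log N := by
  have : (3 : ℝ) ≤ N := by exact_mod_cast hN
  rw [Real.le_log_iff_exp_le (by linarith)]
  exact Real.exp_one_lt_d9.le.trans (by linarith)

lemma Bz_bound : ∃ C > 0, ∀ N : ℕ, 3 ≤ N → |Pz N - Qz N| ≤ C * (N * Real.log N) := by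
  obtain ⟨C, hC, hE⟩ := bz_smooth
  refine ⟨5 * C + 8, by positivity, fun N hN => ?_⟩
  have hlog := log_nat_ge_one hN
  have hN0 : (3 : ℝ) ≤ N := by exact_mod_cast hN
  set h := ⌈(N : ℝ) / Real.log N⌉₊ with hh
  set L := Real.log N with hL
  have hhN : h ≤ N := by
    rw [hh, Nat.ceil_le, div_le_iff₀ (by linarith)]; nlinarith
  have h1 : (N : ℝ) / L ≤ h := Nat.le_ceil _
  have h2 : (h : ℝ) < N / L + 1 := Nat.ceil_lt_add_one (by positivity)
  have hLN : L ≤ N := Real.log_le_self (by linarith)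
  have h3 : (h : ℝ) ≤ 2 * (N / L) := by
    have : 1 ≤ N / L := by rw [one_le_div (by linarith)]; exact hLN
    linarith
  have hpos : 0 < (h : ℝ) := lt_of_lt_of_le (by positivity) h1
  have hlog2 : Real.log ((N + N : ℕ) : ℝ) ^ 2 ≤ 4 * L ^ 2 := by
    have : Real.log ((N + N : ℕ) : ℝ) ≤ 2 * L := by
      have : ((N + N : ℕ) : ℝ) = 2 * N := by push_cast; ring
      rw [this, Real.log_mul (by norm_num) (by linarith)]
      have : Real.log 2 ≤ Real.log N := Real.log_le_log (by norm_num) (by linarith)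
      linarith
    nlinarith [Real.log_natCast_nonneg (N + N)]
  have hE' : ∀ M : ℕ, M ≤ 2 * N → |Ez M| ≤ C * (2 * N) ^ 2 := by
    intro M hM
    refine (hE M).trans ?_
    have : (M : ℝ) ≤ 2 * N := by exact_mod_cast hM
    gcongr
  have hEN : |Ez N| ≤ C * N ^ 2 := hE N
  have hEm : |Ez (N - h)| ≤ C * N ^ 2 := by
    refine (hE (N - h)).trans ?_
    have : ((N - h : ℕ) : ℝ) ≤ N := by exact_mod_cast Nat.sub_le _ _
    gcongr
  have hEp := hE' (N + h) (by omega)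
  have d1 := (Ez_diff N h).1
  have d2 := (Ez_diff (N - h) h).2
  rw [Nat.sub_add_cancel hhN] at d2
  have q1 := Qz_diff N h (N + N) (by omega)
  have q2 := Qz_diff (N - h) h (N + N) (by omega)
  rw [Nat.sub_add_cancel hhN] at q2
  rw [abs_le] at hEN hEm hEp
  have q1' : h * (Qz (N + h) - Qz N) ≤ h * (h * (4 * L ^ 2)) := by
    gcongr; exact q1.trans (by gcongr)
  have q2' : h * (Qz N - Qz (N - h)) ≤ h * (h * (4 * L ^ 2)) := by
    gcongr; exact q2.trans (by gcongr)
  have main : h * |Pz N - Qz N| ≤ 5 * C * N ^ 2 + h * (h * (4 * L ^ 2)) := by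
    rw [← abs_of_pos hpos, ← abs_mul, abs_of_pos hpos, abs_le]
    constructor <;> nlinarith
  have m1 : (N : ℝ) ^ 2 ≤ h * (N * L) := by
    rw [div_le_iff₀ (by linarith)] at h1
    nlinarith
  have m2 : (h : ℝ) * (4 * L ^ 2) ≤ 8 * (N * L) := by
    calc (h : ℝ) * (4 * L ^ 2) ≤ 2 * (N / L) * (4 * L ^ 2) := by gcongr
      _ = _ := by field_simp; ring
  have : h * |Pz N - Qz N| ≤ h * ((5 * C + 8) * (N * L)) := by
    have a1 : 5 * C * N ^ 2 ≤ 5 * C * (h * (N * L)) := by gcongr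
    have a2 : h * (h * (4 * L ^ 2)) ≤ h * (8 * (N * L)) := by gcongr
    linarith
  exact le_of_mul_le_mul_left this hpos

end

section
open Finset ArithmeticFunction

lemma log_ge_two {x : ℝ} (hx : 8 ≤ x) : 2 ≤ Real.log x := by
  have h1 : Real.log 8 ≤ Real.log x := Real.log_le_log (by norm_num) hx
  have h2 : Real.log 8 = 3 * Real.log 2 := by
    rw [show (8 : ℝ) = 2 ^ 3 by norm_num, Real.log_pow]; norm_num
  have := Real.log_two_gt_d9
  linarith

lemma log_sq_le {x : ℝ} (hx : 1 ≤ x) : Real.log x ^ 2 ≤ 16 * Real.sqrt x := by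
  have h0 : 0 ≤ Real.log x := Real.log_nonneg hx
  set y := Real.sqrt (Real.sqrt x) with hy
  have hs : Real.sqrt x ^ 2 = x := Real.sq_sqrt (by linarith)
  have hy2 : y ^ 2 = Real.sqrt x := Real.sq_sqrt (Real.sqrt_nonneg _)
  have hy0 : 0 ≤ y := Real.sqrt_nonneg _
  have h1 : Real.log x = 4 * Real.log y := by
    rw [← hs, ← hy2, Real.log_pow, Real.log_pow]; push_cast; ring
  have h2 : Real.log y ≤ y := Real.log_le_self hy0
  have h3 : 0 ≤ Real.log y := by linarith
  rw [h1, ← hy2]; nlinarith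

lemma one_le_div_log {x : ℝ} (hx : 8 ≤ x) : 1 ≤ 16 * (x / Real.log x ^ 2) := by
  have h := log_sq_le (x := x) (by linarith)
  have h2 := log_ge_two hx
  have : Real.sqrt x ≤ x := by
    rw [Real.sqrt_le_left (by linarith)]; nlinarith
  rw [← mul_div_assoc, one_le_div (by positivity)]; linarith

lemma hd_u (x : ℝ) (hx : 8 ≤ x) : HasDerivAt (fun x => x / Real.log x) (1 / Real.log x - 1 / Real.log x ^ 2) x := by
  have hl := log_ge_two hx
  have := (hasDerivAt_id' x).fun_div (Real.hasDerivAt_log (by linarith : x ≠ 0)) (by linarith)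
  refine this.congr_deriv ?_
  have : x ≠ 0 := by linarith
  field_simp

lemma hd_g (x : ℝ) (hx : 8 ≤ x) : HasDerivAt (fun x => x / Real.log x ^ 3) (1 / Real.log x ^ 3 - 3 / Real.log x ^ 4) x := by
  have hl := log_ge_two hx
  have := (hasDerivAt_id' x).fun_div ((Real.hasDerivAt_log (by linarith : x ≠ 0)).fun_pow 3) (by positivity)
  refine this.congr_deriv ?_
  have : x ≠ 0 := by linarith
  field_simp
  norm_num
  ring

lemma hd_V1 (x : ℝ) (hx : 8 ≤ x) : HasDerivAt (fun x => x ^ 2 / (2 * Real.log x))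
    (x / Real.log x - x / (2 * Real.log x ^ 2)) x := by
  have hl := log_ge_two hx
  have := ((hasDerivAt_id' x).fun_pow 2).fun_div ((Real.hasDerivAt_log (by linarith : x ≠ 0)).const_mul 2) (by positivity)
  refine this.congr_deriv ?_
  have : x ≠ 0 := by linarith
  field_simp
  norm_num
  ring

lemma hd_V2 (x : ℝ) (hx : 8 ≤ x) : HasDerivAt (fun x => x ^ 2 / Real.log x ^ 2)
    (2 * x / Real.log x ^ 2 - 2 * x / Real.log x ^ 3) x := by
  have hl := log_ge_two hx
  have := ((hasDerivAt_id' x).fun_pow 2).fun_div ((Real.hasDerivAt_log (by linarith : x ≠ 0)).fun_pow 2) (by positivity)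
  refine this.congr_deriv ?_
  have : x ≠ 0 := by linarith
  field_simp
  norm_num
  ring

lemma mvt {F F' : ℝ → ℝ} (h : ∀ x, 8 ≤ x → HasDerivAt F (F' x) x) {a b : ℝ} (ha : 8 ≤ a) (hab : a < b) :
    ∃ c, a < c ∧ c < b ∧ F b - F a = (b - a) * F' c := by
  obtain ⟨c, hc, h'⟩ := exists_hasDerivAt_eq_slope F F' hab
    (fun x hx => (h x (ha.trans hx.1)).continuousAt.continuousWithinAt)
    (fun x hx => h x (ha.trans hx.1.le))
  refine ⟨c, hc.1, hc.2, ?_⟩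
  rw [h']; field_simp [sub_ne_zero.mpr hab.ne']

lemma step_u {a b : ℝ} (ha : 8 ≤ a) (hab : a < b) : 0 ≤ b / Real.log b - a / Real.log a ∧
    b / Real.log b - a / Real.log a ≤ b - a := by
  obtain ⟨c, h1, h2, h3⟩ := mvt hd_u ha hab
  have hl := log_ge_two (ha.trans h1.le)
  rw [h3]
  have e : 0 ≤ 1 / Real.log c - 1 / Real.log c ^ 2 := by
    rw [sub_nonneg, div_le_div_iff₀ (by positivity) (by positivity)]; nlinarith
  have e2 : 1 / Real.log c ≤ 1 := by rw [div_le_one (by linarith)]; linarith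
  have e3 : 0 ≤ 1 / Real.log c ^ 2 := by positivity
  constructor
  · exact mul_nonneg (by linarith) e
  · nlinarith

lemma log_succ_le {x y : ℝ} (hx : 8 ≤ x) (hy0 : 0 < y) (hy : y ≤ x + 1) : Real.log y ≤ 2 * Real.log x := by
  have : Real.log (x ^ 2) = 2 * Real.log x := by rw [Real.log_pow]; norm_num
  rw [← this]
  exact Real.log_le_log hy0 (by nlinarith)

lemma step_g {a : ℝ} (ha : 8 ≤ a) : |(a + 1) / Real.log (a + 1) ^ 3 - a / Real.log a ^ 3| ≤ 1 / Real.log a ^ 3 := by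
  obtain ⟨c, h1, h2, h3⟩ := mvt hd_g ha (show a < a + 1 by linarith)
  have hl := log_ge_two (ha.trans h1.le)
  have hla := log_ge_two ha
  have hmono : Real.log a ≤ Real.log c := Real.log_le_log (by linarith) h1.le
  rw [h3, add_sub_cancel_left, one_mul]
  have : |1 / Real.log c ^ 3 - 3 / Real.log c ^ 4| ≤ 1 / Real.log c ^ 3 := by
    have e : 3 / Real.log c ^ 4 ≤ 2 / Real.log c ^ 3 := by
      rw [div_le_div_iff₀ (by positivity) (by positivity)]
      have : 0 < Real.log c ^ 3 := by positivity
      nlinarith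
    have e0 : 0 ≤ 3 / Real.log c ^ 4 := by positivity
    have e1 : 2 / Real.log c ^ 3 = 2 * (1 / Real.log c ^ 3) := by ring
    rw [abs_le]; constructor <;> linarith
  refine this.trans ?_
  gcongr

lemma step_V1 {a : ℝ} (ha : 8 ≤ a) : |(a + 1) / Real.log (a + 1) - ((a + 1) ^ 2 / (2 * Real.log (a + 1)) -
    a ^ 2 / (2 * Real.log a))| ≤ 17 * (a / Real.log a ^ 2) := by
  obtain ⟨c, h1, h2, h3⟩ := mvt hd_V1 ha (show a < a + 1 by linarith)
  have hla := log_ge_two ha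
  have hmono : Real.log a ≤ Real.log c := Real.log_le_log (by linarith) h1.le
  have hu := step_u (ha.trans h1.le) h2
  have h1' := one_le_div_log ha
  rw [h3, add_sub_cancel_left, one_mul]
  have e : c / (2 * Real.log c ^ 2) ≤ a / Real.log a ^ 2 := by
    calc c / (2 * Real.log c ^ 2) ≤ (2 * a) / (2 * Real.log a ^ 2) := by gcongr; linarith
      _ = _ := by field_simp
  have e0 : 0 ≤ c / (2 * Real.log c ^ 2) := by have := ha.trans h1.le; positivity
  rw [abs_le]; constructor <;> linarith

lemma step_V2 {a : ℝ} (ha : 8 ≤ a) : a / Real.log a ^ 2 ≤ 4 * ((a + 1) ^ 2 / Real.log (a + 1) ^ 2 -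
    a ^ 2 / Real.log a ^ 2) := by
  obtain ⟨c, h1, h2, h3⟩ := mvt hd_V2 ha (show a < a + 1 by linarith)
  have hla := log_ge_two ha
  have hlc := log_ge_two (ha.trans h1.le)
  have hl := log_succ_le (y := c) ha (by linarith) h2.le
  rw [h3, add_sub_cancel_left, one_mul]
  have hc : 0 < c := by linarith
  have e : c / Real.log c ^ 2 ≤ 2 * c / Real.log c ^ 2 - 2 * c / Real.log c ^ 3 := by
    have : 2 * c / Real.log c ^ 3 ≤ c / Real.log c ^ 2 := by
      rw [div_le_div_iff₀ (by positivity) (by positivity)]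
      have : 0 < c * Real.log c ^ 2 := by positivity
      nlinarith
    have e1 : 2 * c / Real.log c ^ 2 = 2 * (c / Real.log c ^ 2) := by ring
    linarith
  have e2 : a / (2 * Real.log a) ^ 2 ≤ c / Real.log c ^ 2 := by gcongr
  have e3 : a / (2 * Real.log a) ^ 2 = (a / Real.log a ^ 2) / 4 := by field_simp; norm_num
  linarith

end

section
open Finset ArithmeticFunction

noncomputable def dz (n : ℕ) : ℝ := (if n.Prime then Real.log n ^ 3 else 0) - Real.log n ^ 2
noncomputable def Dz (m : ℕ) : ℝ := ∑ n ∈ Finset.Icc 1 m, dz n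

lemma not_prime_sum : ∃ C > 0, ∀ N : ℕ, ∑ n ∈ Finset.Icc 1 N, (if n.Prime then 0 else vonMangoldt n)
    ≤ C * Real.sqrt N := by
  obtain ⟨C, hC⟩ := Chebyshev.psi_sub_theta_le_mul_sqrt
  refine ⟨|C| + 1, by positivity, fun N => ?_⟩
  have h := hC N
  rw [Chebyshev.psi_sub_theta_eq_sum_not_prime, Nat.floor_natCast, Finset.sum_filter] at h
  have e : Finset.Ioc 0 N = Finset.Icc 1 N := rfl
  rw [e] at h
  calc _ = _ := by refine Finset.sum_congr rfl fun n _ => ?_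
                   by_cases hp : n.Prime <;> simp [hp]
    _ ≤ _ := h
    _ ≤ _ := by
      have := le_abs_self C
      have := Real.sqrt_nonneg N
      nlinarith

lemma Dz_bound : ∃ C > 0, ∀ N : ℕ, 3 ≤ N → |Dz N| ≤ C * (N * Real.log N) := by
  obtain ⟨C, hC, hB⟩ := Bz_bound
  obtain ⟨C', hC', hN⟩ := not_prime_sum
  refine ⟨C + 16 * C', by positivity, fun N h3 => ?_⟩
  have hlog := log_nat_ge_one h3
  have hN0 : (3 : ℝ) ≤ N := by exact_mod_cast h3
  set R := ∑ n ∈ Finset.Icc 1 N, Real.log n ^ 2 * (if n.Prime then 0 else vonMangoldt n) with hR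
  have e : Dz N = (Pz N - Qz N) - R := by
    unfold Dz Pz Qz
    rw [hR, ← Finset.sum_sub_distrib, ← Finset.sum_sub_distrib]
    refine Finset.sum_congr rfl fun n _ => ?_
    unfold dz
    by_cases hp : n.Prime
    · simp [hp, vonMangoldt_apply_prime hp]; ring
    · simp [hp]
  have hnn : ∀ n : ℕ, 0 ≤ (if n.Prime then 0 else vonMangoldt n) := by
    intro n; split_ifs; exacts [le_rfl, vonMangoldt_nonneg]
  have hR0 : 0 ≤ R := Finset.sum_nonneg fun n _ => mul_nonneg (sq_nonneg _) (hnn n)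
  have hR1 : R ≤ 16 * C' * (N * Real.log N) := by
    calc R ≤ ∑ n ∈ Finset.Icc 1 N, Real.log N ^ 2 * (if n.Prime then 0 else vonMangoldt n) := by
          refine Finset.sum_le_sum fun n hn => mul_le_mul_of_nonneg_right ?_ (hnn n)
          rw [Finset.mem_Icc] at hn
          exact pow_le_pow_left₀ (Real.log_natCast_nonneg _) (Real.log_le_log (by exact_mod_cast hn.1) (by exact_mod_cast hn.2)) 2
      _ = Real.log N ^ 2 * _ := by rw [← Finset.mul_sum]
      _ ≤ (16 * Real.sqrt N) * (C' * Real.sqrt N) := by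
          gcongr
          · exact log_sq_le (by linarith)
          · exact hN N
      _ = 16 * C' * (Real.sqrt N * Real.sqrt N) := by ring
      _ = 16 * C' * N := by rw [Real.mul_self_sqrt (by linarith)]
      _ ≤ _ := by gcongr; nlinarith
  have := hB N h3
  rw [abs_le] at this
  rw [e, abs_le]
  constructor <;> linarith

noncomputable def Sz (m : ℕ) : ℝ := ∑ n ∈ Finset.Icc 1 m, (if n.Prime then (n : ℝ) else 0)

lemma Sz_nat : ∃ C > 0, ∀ N : ℕ, 8 ≤ N → |Sz N - (N : ℝ) ^ 2 / (2 * Real.log N)| ≤ C * ((N : ℝ) ^ 2 / Real.log N ^ 2) := by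
  obtain ⟨C, hC, hD⟩ := Dz_bound
  let R : ℕ → ℝ := fun N => Sz N - (N : ℝ) ^ 2 / (2 * Real.log N) - Dz N * (N / Real.log N ^ 3)
  let V : ℕ → ℝ := fun N => (N : ℝ) ^ 2 / Real.log N ^ 2
  have hV1 : ∀ N : ℕ, 8 ≤ N → 1 ≤ 16 * V N := by
    intro N hN
    have hN8 : (8 : ℝ) ≤ N := by exact_mod_cast hN
    have := one_le_div_log hN8
    have hl := log_ge_two hN8
    have : (N : ℝ) / Real.log N ^ 2 ≤ V N := by
      simp only [V]; gcongr; nlinarith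
    linarith
  have hstep : ∀ N : ℕ, 8 ≤ N → |R (N + 1) - R N| ≤ (4 * (17 + C)) * (V (N + 1) - V N) := by
    intro N hN
    have hN8 : (8 : ℝ) ≤ N := by exact_mod_cast hN
    have hl := log_ge_two hN8
    have hl1 := log_ge_two (show (8 : ℝ) ≤ N + 1 by linarith)
    have e : R (N + 1) - R N = ((N + 1) / Real.log (N + 1) - (((N : ℝ) + 1) ^ 2 / (2 * Real.log (N + 1)) -
        N ^ 2 / (2 * Real.log N))) - Dz N * ((N + 1) / Real.log (N + 1) ^ 3 - N / Real.log N ^ 3) := by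
      have e1 : Dz (N + 1) = Dz N + dz (N + 1) := by
        unfold Dz; rw [Finset.sum_Icc_succ_top (by omega)]
      have e2 : Sz (N + 1) = Sz N + (if (N + 1).Prime then ((N : ℝ) + 1) else 0) := by
        unfold Sz; rw [Finset.sum_Icc_succ_top (by omega)]; push_cast; rfl
      have e3 : (if (N + 1).Prime then ((N : ℝ) + 1) else 0) =
          (dz (N + 1) + Real.log (N + 1) ^ 2) * ((N + 1) / Real.log (N + 1) ^ 3) := by
        unfold dz; push_cast
        split_ifs
        · rw [sub_add_cancel]; field_simp
        · simp
      have e4 : Real.log ((N : ℝ) + 1) ^ 2 * ((N + 1) / Real.log (N + 1) ^ 3) = (N + 1) / Real.log (N + 1) := by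
        field_simp
      simp only [R]
      rw [e1, e2, e3]; push_cast; linarith
    have b1 := step_V1 hN8
    have b2 := step_g hN8
    have b3 := step_V2 hN8
    have b4 := hD N (by omega)
    have b5 : |Dz N * ((N + 1) / Real.log (N + 1) ^ 3 - N / Real.log N ^ 3)| ≤ C * (N / Real.log N ^ 2) := by
      rw [abs_mul]
      calc _ ≤ (C * (N * Real.log N)) * (1 / Real.log N ^ 3) := by gcongr
        _ = _ := by field_simp
    rw [e]
    refine (abs_sub _ _).trans ?_
    have b3' : (N : ℝ) / Real.log N ^ 2 ≤ 4 * (V (N + 1) - V N) := by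
      simp only [V]; push_cast; exact b3
    nlinarith
  have hR : ∀ N : ℕ, 8 ≤ N → |R N| ≤ |R 8| + (4 * (17 + C)) * (V N - V 8) := by
    intro N hN
    induction N, hN using Nat.le_induction with
    | base => simp
    | succ N hN ih =>
      have := hstep N hN
      have h2 : |R (N + 1)| ≤ |R N| + |R (N + 1) - R N| := by
        have := abs_add_le (R N) (R (N + 1) - R N)
        rwa [add_sub_cancel] at this
      linarith
  refine ⟨16 * |R 8| + 4 * (17 + C) + C, by positivity, fun N hN => ?_⟩
  have hN8 : (8 : ℝ) ≤ N := by exact_mod_cast hN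
  have hl := log_ge_two hN8
  have a1 := hR N hN
  have a2 := hV1 N hN
  have a3 := hV1 8 le_rfl
  have a4 : |Dz N * (N / Real.log N ^ 3)| ≤ C * V N := by
    rw [abs_mul, abs_of_nonneg (show 0 ≤ (N : ℝ) / Real.log N ^ 3 by positivity)]
    calc _ ≤ (C * (N * Real.log N)) * (N / Real.log N ^ 3) := by gcongr; exact hD N (by omega)
      _ = _ := by simp only [V]; field_simp
  have a5 : Sz N - (N : ℝ) ^ 2 / (2 * Real.log N) = R N + Dz N * (N / Real.log N ^ 3) := by
    simp only [R]; ring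
  rw [a5]
  refine (abs_add_le _ _).trans ?_
  change _ ≤ _ * V N
  have a6 : |R 8| ≤ |R 8| * (16 * V N) := le_mul_of_one_le_right (abs_nonneg _) a2
  nlinarith

lemma Sz_real : ∃ C > 0, ∀ x : ℝ, 9 ≤ x → |Sz ⌊x⌋₊ - x ^ 2 / (2 * Real.log x)| ≤ C * (x ^ 2 / Real.log x ^ 2) := by
  obtain ⟨C, hC, hS⟩ := Sz_nat
  refine ⟨4 * C + 16, by positivity, fun x hx => ?_⟩
  set N := ⌊x⌋₊ with hN
  have h1 : (N : ℝ) ≤ x := Nat.floor_le (by linarith)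
  have h2 : x < N + 1 := Nat.lt_floor_add_one x
  have hN8 : (8 : ℝ) ≤ N := by linarith
  have h3 := hS N (by exact_mod_cast hN8)
  have hl := log_ge_two hN8
  have hlx := log_ge_two (show 8 ≤ x by linarith)
  have hlog := log_succ_le hN8 (show 0 < x by linarith) h2.le
  have h4 : (N : ℝ) ^ 2 / Real.log N ^ 2 ≤ 4 * (x ^ 2 / Real.log x ^ 2) := by
    calc (N : ℝ) ^ 2 / Real.log N ^ 2 ≤ x ^ 2 / (Real.log x / 2) ^ 2 := by gcongr; linarith
      _ = _ := by field_simp; norm_num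
  have h5 : |(N : ℝ) ^ 2 / (2 * Real.log N) - x ^ 2 / (2 * Real.log x)| ≤ 16 * (x ^ 2 / Real.log x ^ 2) := by
    rcases h1.eq_or_lt with h | h
    · rw [h]; simp; positivity
    · obtain ⟨c, c1, c2, c3⟩ := mvt hd_V1 hN8 h
      rw [abs_sub_comm, c3]
      have hlc := log_ge_two (hN8.trans c1.le)
      have hc : 0 < c := by linarith
      have d1 : c / (2 * Real.log c ^ 2) ≤ c / Real.log c := by
        rw [div_le_div_iff₀ (by positivity) (by positivity)]
        have : 0 < c * Real.log c := by positivity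
        nlinarith
      have d2 : c / Real.log c ≤ c := div_le_self hc.le (by linarith)
      have d3 : 0 ≤ c / (2 * Real.log c ^ 2) := by positivity
      have d4 := one_le_div_log (show 8 ≤ x by linarith)
      have d5 : x ≤ 16 * (x ^ 2 / Real.log x ^ 2) := by
        calc x ≤ x * (16 * (x / Real.log x ^ 2)) := le_mul_of_one_le_right (by linarith) d4
          _ = _ := by ring
      rw [abs_of_nonneg (mul_nonneg (by linarith) (by linarith))]
      refine le_trans ?_ d5
      nlinarith
  have := abs_sub_le (Sz N) ((N : ℝ) ^ 2 / (2 * Real.log N)) (x ^ 2 / (2 * Real.log x))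
  nlinarith

end

section
open Finset ArithmeticFunction

lemma Sz_nonneg (m : ℕ) : 0 ≤ Sz m := Finset.sum_nonneg fun n _ => by split_ifs <;> positivity

lemma Sz_le (m : ℕ) : Sz m ≤ (m : ℝ) ^ 2 := by
  unfold Sz
  calc _ ≤ ∑ n ∈ Finset.Icc 1 m, (m : ℝ) := by
        refine Finset.sum_le_sum fun n hn => ?_
        rw [Finset.mem_Icc] at hn
        split_ifs
        · exact_mod_cast hn.2
        · positivity
    _ = _ := by simp; ring

lemma log_sq_le4 {x : ℝ} (hx : 1 ≤ x) : Real.log x ^ 2 ≤ 64 * x ^ (1 / 4 : ℝ) := by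
  have h0 : 0 ≤ Real.log x := Real.log_nonneg hx
  have h := Real.log_le_rpow_div (x := x) (ε := 1 / 8) (by linarith) (by norm_num)
  have e : x ^ (1 / 4 : ℝ) = (x ^ (1 / 8 : ℝ)) ^ 2 := by
    rw [← Real.rpow_natCast, ← Real.rpow_mul (by linarith)]; norm_num
  rw [e]
  have : Real.log x ≤ 8 * x ^ (1 / 8 : ℝ) := by linarith
  nlinarith

lemma term_bound : ∃ C > 0, ∀ x : ℝ, 81 ≤ x → ∀ k : ℕ,
    |Sz ⌊x / k⌋₊ - x ^ 2 / (2 * Real.log x) * (1 / (k : ℝ) ^ 2)| ≤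
      C * (x ^ 2 / Real.log x ^ 2) * (1 / (k : ℝ) ^ (3 / 2 : ℝ)) := by
  obtain ⟨C, hC, hS⟩ := Sz_real
  refine ⟨4 * C + 2 + 64, by positivity, fun x hx k => ?_⟩
  have hL := log_ge_two (show 8 ≤ x by linarith)
  set L := Real.log x with hLdef
  rcases Nat.eq_zero_or_pos k with rfl | hk
  · simp [Sz]
  have hk1 : (1 : ℝ) ≤ k := by exact_mod_cast hk
  have hk32 : (k : ℝ) ^ (3 / 2 : ℝ) * (k : ℝ) ^ (1 / 2 : ℝ) = (k : ℝ) ^ 2 := by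
    rw [← Real.rpow_add (by linarith), ← Real.rpow_natCast]; norm_num
  have hk12 : 1 ≤ (k : ℝ) ^ (1 / 2 : ℝ) := Real.one_le_rpow hk1 (by norm_num)
  set u := (k : ℝ) ^ (3 / 2 : ℝ) with hu
  set v := (k : ℝ) ^ (1 / 2 : ℝ) with hv
  have hu0 : 0 < u := by positivity
  have hv2 : v ^ 2 = k := by
    rw [hv, ← Real.rpow_natCast, ← Real.rpow_mul (by linarith)]; norm_num
  rw [← hk32]
  have hW : 0 ≤ x ^ 2 / L ^ 2 * (1 / u) := by positivity
  by_cases hkx : (k : ℝ) ^ 2 ≤ x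
  · have hxk : Real.sqrt x ≤ x / k := by
      rw [le_div_iff₀ (by linarith)]
      have : (k : ℝ) ≤ Real.sqrt x := Real.le_sqrt_of_sq_le hkx
      calc _ ≤ Real.sqrt x * Real.sqrt x := by gcongr
        _ = x := Real.mul_self_sqrt (by linarith)
    have h9 : 9 ≤ Real.sqrt x := Real.le_sqrt_of_sq_le (by linarith)
    have hs := hS (x / k) (by linarith)
    have hlk : Real.log (x / k) = L - Real.log k := by rw [Real.log_div (by linarith) (by linarith)]
    have hl2 : L / 2 ≤ Real.log (x / k) := by
      rw [hLdef, ← Real.log_sqrt (by linarith)]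
      exact Real.log_le_log (by linarith) hxk
    set l := Real.log (x / k) with hl
    have hl0 : 0 < l := by linarith
    have hlogk0 : 0 ≤ Real.log k := Real.log_natCast_nonneg _
    have hlogk : Real.log k ≤ 2 * v := by
      have := Real.log_le_rpow_div (x := k) (ε := 1 / 2) (by linarith) (by norm_num)
      rw [← hv] at this; linarith
    have t1 : C * ((x / k) ^ 2 / l ^ 2) ≤ 4 * C * (x ^ 2 / L ^ 2 * (1 / u)) := by
      calc C * ((x / k) ^ 2 / l ^ 2) ≤ C * ((x / k) ^ 2 / (L / 2) ^ 2) := by gcongr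
        _ = 4 * C * (x ^ 2 / L ^ 2 * (1 / k ^ 2)) := by field_simp; norm_num
        _ ≤ _ := by
          rw [← hk32]; gcongr
          exact le_mul_of_one_le_right hu0.le hk12
    have t2 : |(x / k) ^ 2 / (2 * l) - x ^ 2 / (2 * L) * (1 / (u * v))| ≤ 2 * (x ^ 2 / L ^ 2 * (1 / u)) := by
      have e : (x / k) ^ 2 / (2 * l) - x ^ 2 / (2 * L) * (1 / (u * v)) =
          x ^ 2 / 2 * (1 / (u * v)) * (Real.log k / (l * L)) := by
        have : Real.log k = L - l := by linarith
        rw [this, div_pow, ← hk32]; field_simp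
      rw [e, abs_of_nonneg (by positivity)]
      calc _ ≤ x ^ 2 / 2 * (1 / (u * v)) * ((2 * v) / (L / 2 * L)) := by gcongr
        _ = _ := by field_simp
    have := abs_sub_le (Sz ⌊x / k⌋₊) ((x / k) ^ 2 / (2 * l)) (x ^ 2 / (2 * L) * (1 / (u * v)))
    nlinarith
  · push Not at hkx
    have hxv : x ^ (1 / 4 : ℝ) ≤ v := by
      calc x ^ (1 / 4 : ℝ) ≤ ((k : ℝ) ^ 2) ^ (1 / 4 : ℝ) := by gcongr
        _ = v := by rw [hv, ← Real.rpow_natCast, ← Real.rpow_mul (by linarith)]; norm_num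
    have hL4 := log_sq_le4 (show 1 ≤ x by linarith)
    have hbd : x ^ 2 * (1 / (u * v)) ≤ 64 * (x ^ 2 / L ^ 2 * (1 / u)) := by
      have : x ^ 2 * (1 / (u * v)) = x ^ 2 * (1 / u) * (1 / v) := by field_simp
      rw [this]
      have h : 1 / v ≤ 64 / L ^ 2 := by
        rw [div_le_div_iff₀ (by linarith) (by positivity)]; linarith
      calc _ ≤ x ^ 2 * (1 / u) * (64 / L ^ 2) := by gcongr
        _ = _ := by ring
    have a1 : Sz ⌊x / k⌋₊ ≤ x ^ 2 * (1 / (u * v)) := by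
      refine (Sz_le _).trans ?_
      have : (⌊x / k⌋₊ : ℝ) ≤ x / k := Nat.floor_le (by positivity)
      calc _ ≤ (x / k) ^ 2 := by gcongr
        _ = _ := by rw [div_pow, hk32]; ring
    have a2 := Sz_nonneg ⌊x / k⌋₊
    have a3 : x ^ 2 / (2 * L) * (1 / (u * v)) ≤ x ^ 2 * (1 / (u * v)) := by
      gcongr; exact div_le_self (by positivity) (by linarith)
    have a4 : 0 ≤ x ^ 2 / (2 * L) * (1 / (u * v)) := by positivity
    have a5 : (4 * C + 2 + 64) * (x ^ 2 / L ^ 2) * (1 / u) = (4 * C + 2) * (x ^ 2 / L ^ 2 * (1 / u)) + 64 * (x ^ 2 / L ^ 2 * (1 / u)) := by ring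
    have a6 : 0 ≤ (4 * C + 2) * (x ^ 2 / L ^ 2 * (1 / u)) := by positivity
    rw [abs_le]; constructor <;> linarith

lemma Sz_avg : ∃ C > 0, ∀ x : ℝ, 81 ≤ x →
    |∑ k ∈ Finset.Icc 1 ⌊x⌋₊, Sz ⌊x / k⌋₊ - Real.pi ^ 2 * x ^ 2 / (12 * Real.log x)| ≤ C * (x ^ 2 / Real.log x ^ 2) := by
  obtain ⟨C, hC, h⟩ := term_bound
  have hsum : Summable fun k : ℕ => 1 / (k : ℝ) ^ (3 / 2 : ℝ) := Real.summable_one_div_nat_rpow.mpr (by norm_num)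
  set Z := ∑' k : ℕ, 1 / (k : ℝ) ^ (3 / 2 : ℝ) with hZ
  have hZ0 : 0 ≤ Z := tsum_nonneg fun k => by positivity
  refine ⟨C * Z + 1, by positivity, fun x hx => ?_⟩
  have h1 : HasSum (fun k : ℕ => Sz ⌊x / k⌋₊) (∑ k ∈ Finset.Icc 1 ⌊x⌋₊, Sz ⌊x / k⌋₊) := by
    refine hasSum_sum_of_ne_finset_zero fun k hk => ?_
    have : ⌊x / k⌋₊ = 0 := by
      rcases Nat.eq_zero_or_pos k with rfl | hk0
      · simp
      · rw [Nat.floor_eq_zero, div_lt_one (by exact_mod_cast hk0)]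
        by_contra hc
        push Not at hc
        exact hk (Finset.mem_Icc.mpr ⟨hk0, Nat.le_floor hc⟩)
    rw [this]; simp [Sz]
  have h2 := (h1.sub (hasSum_zeta_two.mul_left (x ^ 2 / (2 * Real.log x)))).tsum_eq
  have h3 := tsum_of_norm_bounded (hsum.hasSum.mul_left (C * (x ^ 2 / Real.log x ^ 2))) (f := fun k : ℕ => Sz ⌊x / k⌋₊ - x ^ 2 / (2 * Real.log x) * (1 / (k : ℝ) ^ 2)) (h x hx)
  rw [h2, Real.norm_eq_abs] at h3
  have e : x ^ 2 / (2 * Real.log x) * (Real.pi ^ 2 / 6) = Real.pi ^ 2 * x ^ 2 / (12 * Real.log x) := by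
    rw [div_mul_div_comm]; congr 1 <;> ring
  rw [e] at h3
  refine h3.trans ?_
  have : 0 ≤ x ^ 2 / Real.log x ^ 2 := by positivity
  nlinarith

end

section
open Finset ArithmeticFunction

lemma sum_primeFactors_eq (N : ℕ) : ∑ n ∈ Finset.Icc 1 N, ∑ p ∈ n.primeFactors, (p : ℝ) =
    ∑ k ∈ Finset.Icc 1 N, Sz (N / k) := by
  let g : ArithmeticFunction ℝ := ⟨fun n => if n.Prime then (n : ℝ) else 0, by simp⟩
  have h := sum_Ioc_mul_eq_sum_sum (ArithmeticFunction.zeta : ArithmeticFunction ℝ) g N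
  have e : Finset.Ioc 0 N = Finset.Icc 1 N := rfl
  rw [e] at h
  calc _ = ∑ n ∈ Finset.Icc 1 N, ((ArithmeticFunction.zeta : ArithmeticFunction ℝ) * g) n := by
        refine Finset.sum_congr rfl fun n hn => ?_
        rw [coe_zeta_mul_apply, Nat.primeFactors_eq_to_filter_divisors_prime, Finset.sum_filter]
        rfl
    _ = _ := h
    _ = _ := by
        refine Finset.sum_congr rfl fun n hn => ?_
        rw [Finset.mem_Icc] at hn
        have : (ArithmeticFunction.zeta : ArithmeticFunction ℝ) n = 1 := by
          simp [zeta_apply, show n ≠ 0 by omega]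
        rw [this, one_mul]; rfl

noncomputable def hz8 : ArithmeticFunction ℝ :=
  ⟨fun n => n * (if n.Prime then 0 else vonMangoldt n), by simp⟩

lemma hz8_nonneg (n : ℕ) : 0 ≤ hz8 n := by
  change 0 ≤ (n : ℝ) * (if n.Prime then 0 else vonMangoldt n)
  split_ifs
  · simp
  · exact mul_nonneg (by positivity) vonMangoldt_nonneg

lemma hz8_sum : ∃ C > 0, ∀ N : ℕ, ∑ n ∈ Finset.Icc 1 N, ∑ d ∈ n.divisors, hz8 d ≤ C * (N * Real.sqrt N) := by
  obtain ⟨C, hC, h⟩ := not_prime_sum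
  refine ⟨C, hC, fun N => ?_⟩
  have h1 := sum_Ioc_mul_zeta_eq_sum hz8 N
  have e : Finset.Ioc 0 N = Finset.Icc 1 N := rfl
  rw [e] at h1
  simp_rw [coe_mul_zeta_apply] at h1
  rw [h1]
  calc _ ≤ ∑ n ∈ Finset.Icc 1 N, N * (if n.Prime then 0 else vonMangoldt n) := by
        refine Finset.sum_le_sum fun n hn => ?_
        rw [Finset.mem_Icc] at hn
        change ((n : ℝ) * (if n.Prime then 0 else vonMangoldt n)) * _ ≤ _
        have a : 0 ≤ (if n.Prime then 0 else vonMangoldt n) := by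
          split_ifs
          · simp
          · exact vonMangoldt_nonneg
        have b : (n : ℝ) * ((N / n : ℕ) : ℝ) ≤ N := by exact_mod_cast Nat.mul_div_le N n
        calc _ = ((n : ℝ) * ((N / n : ℕ) : ℝ)) * (if n.Prime then 0 else vonMangoldt n) := by ring
          _ ≤ _ := by gcongr
    _ = N * _ := by rw [← Finset.mul_sum]
    _ ≤ N * (C * Real.sqrt N) := by gcongr; exact h N
    _ = _ := by ring

lemma f_eq (f : ℕ → ℂ) (hadd : ∀ m n : ℕ, Nat.Coprime m n → f (m * n) = f m + f n) (n : ℕ) (hn : n ≠ 0) :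
    f n = ∑ p ∈ n.primeFactors, f (p ^ n.factorization p) := by
  have h1 : f 1 = 0 := by
    have := hadd 1 1 (by simp)
    simpa using this
  have := Nat.multiplicative_factorization (fun n => Multiplicative.ofAdd (f n))
    (fun x y hxy => by rw [hadd x y hxy]; rfl) (by simp [h1]) hn
  have h2 := congrArg Multiplicative.toAdd this
  simpa [Finsupp.prod, toAdd_prod] using h2

lemma diff_bound (f : ℕ → ℂ)
    (hadd : ∀ m n : ℕ, Nat.Coprime m n → f (m * n) = f m + f n)
    (hp1 : ∀ p : ℕ, p.Prime → f p = (p : ℂ)) (l : ℕ) (K : ℝ)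
    (hK : ∀ p : ℕ, p.Prime → ∀ ν : ℕ, 2 ≤ ν → ‖f (p ^ ν)‖ ≤ K * (ν : ℝ) ^ l * (p : ℝ) ^ ν)
    (n : ℕ) (hn : n ≠ 0) (x : ℝ) (hnx : n ≤ x) :
    ‖f n - ((∑ p ∈ n.primeFactors, (p : ℝ) : ℝ) : ℂ)‖ ≤
      (|K| + 1) * (Real.log x / Real.log 2) ^ l / Real.log 2 * ∑ d ∈ n.divisors, hz8 d := by
  have hl2 := Real.log_pos one_lt_two
  have hn1 : (1 : ℝ) ≤ n := by exact_mod_cast Nat.pos_of_ne_zero hn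
  have hlx : 0 ≤ Real.log x := Real.log_nonneg (by linarith)
  set B := (|K| + 1) * (Real.log x / Real.log 2) ^ l / Real.log 2 with hB
  have hB0 : 0 ≤ B := by positivity
  rw [f_eq f hadd n hn, Complex.ofReal_sum, ← Finset.sum_sub_distrib]
  refine (norm_sum_le _ _).trans ?_
  have hterm : ∀ p ∈ n.primeFactors, ‖f (p ^ n.factorization p) - ((p : ℝ) : ℂ)‖ ≤ B * hz8 (p ^ n.factorization p) := by
    intro p hp
    have hpp := Nat.prime_of_mem_primeFactors hp
    have hv : 1 ≤ n.factorization p := by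
      rw [← hpp.dvd_iff_one_le_factorization hn]; exact Nat.dvd_of_mem_primeFactors hp
    have hle : p ^ n.factorization p ≤ n := Nat.ordProj_le p hn
    set v := n.factorization p with hvdef
    rcases hv.eq_or_lt with h | h
    · rw [← h, pow_one, hp1 p hpp]
      simp only [Complex.ofReal_natCast, sub_self, norm_zero]
      exact mul_nonneg hB0 (hz8_nonneg _)
    · have hp2 : (2 : ℝ) ≤ p := by exact_mod_cast hpp.two_le
      have hv1 : (1 : ℝ) ≤ v := by exact_mod_cast hv
      have hvx : (v : ℝ) ≤ Real.log x / Real.log 2 := by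
        rw [le_div_iff₀ hl2, ← Real.log_pow]
        refine Real.log_le_log (by positivity) ?_
        calc (2 : ℝ) ^ v ≤ (p : ℝ) ^ v := by gcongr
          _ ≤ n := by exact_mod_cast hle
          _ ≤ x := hnx
      have hh : hz8 (p ^ v) = (p : ℝ) ^ v * Real.log p := by
        change (((p ^ v : ℕ)) : ℝ) * (if (p ^ v).Prime then 0 else vonMangoldt (p ^ v)) = _
        rw [if_neg (Nat.Prime.not_prime_pow h), vonMangoldt_apply_pow (by omega), vonMangoldt_apply_prime hpp]
        push_cast; rfl
      have hlogp : Real.log 2 ≤ Real.log p := Real.log_le_log (by norm_num) hp2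
      have q1 : (p : ℝ) ≤ (p : ℝ) ^ v := le_self_pow₀ (by linarith) (by omega)
      have q2 : (1 : ℝ) ≤ (v : ℝ) ^ l := one_le_pow₀ hv1
      have q3 := hK p hpp v h
      have q4 : K * (v : ℝ) ^ l * (p : ℝ) ^ v ≤ |K| * (v : ℝ) ^ l * (p : ℝ) ^ v := by
        gcongr; exact le_abs_self K
      have q5 : ‖((p : ℝ) : ℂ)‖ ≤ (v : ℝ) ^ l * (p : ℝ) ^ v := by
        rw [Complex.norm_real, Real.norm_eq_abs, abs_of_nonneg (by linarith)]
        exact q1.trans (le_mul_of_one_le_left (by positivity) q2)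
      calc _ ≤ ‖f (p ^ v)‖ + ‖((p : ℝ) : ℂ)‖ := norm_sub_le _ _
        _ ≤ (|K| + 1) * (v : ℝ) ^ l * (p : ℝ) ^ v := by linarith
        _ ≤ (|K| + 1) * (Real.log x / Real.log 2) ^ l * (p : ℝ) ^ v := by gcongr
        _ = B * ((p : ℝ) ^ v * Real.log 2) := by rw [hB]; field_simp
        _ ≤ B * hz8 (p ^ v) := by rw [hh]; gcongr
  refine (Finset.sum_le_sum hterm).trans ?_
  rw [← Finset.mul_sum]
  refine mul_le_mul_of_nonneg_left ?_ hB0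
  have hinj : Set.InjOn (fun p => p ^ n.factorization p) (n.primeFactors : Set ℕ) := by
    intro p hp q hq hpq
    have hpp := Nat.prime_of_mem_primeFactors hp
    have hqq := Nat.prime_of_mem_primeFactors hq
    have hv : n.factorization p ≠ 0 := by
      have : 1 ≤ n.factorization p := by
        rw [← hpp.dvd_iff_one_le_factorization hn]; exact Nat.dvd_of_mem_primeFactors hp
      omega
    have : p ∣ q ^ n.factorization q := by
      have : p ∣ p ^ n.factorization p := dvd_pow_self p hv
      simp only at hpq
      rwa [hpq] at this
    exact (Nat.prime_dvd_prime_iff_eq hpp hqq).mp (hpp.dvd_of_dvd_pow this)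
  rw [← Finset.sum_image (f := fun d => hz8 d) hinj]
  refine Finset.sum_le_sum_of_subset_of_nonneg ?_ fun _ _ _ => hz8_nonneg _
  intro d hd
  rw [Finset.mem_image] at hd
  obtain ⟨p, -, rfl⟩ := hd
  exact Nat.mem_divisors.mpr ⟨Nat.ordProj_dvd n p, hn⟩

end

/-- **Mean value of functions in the class `F₁`** (Theorem `Th_f_additive_1`).
`F₁` is the class of additive `f : ℕ → ℂ` with `f p = p` for every prime `p` and
`|f (p^ν)| ≤ K ν^ℓ p^ν` uniformly for primes `p` and `ν ≥ 2`. For such `f`: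
`Σ_{n ≤ x} f n = π² x² / (12 log x) + O(x²/(log x)²)`. -/
theorem stmt_13 (f : ℕ → ℂ)
    (hadd : ∀ m n : ℕ, Nat.Coprime m n → f (m * n) = f m + f n)
    (hp1 : ∀ p : ℕ, p.Prime → f p = (p : ℂ))
    (hbound : ∃ (l : ℕ) (K : ℝ), ∀ p : ℕ, p.Prime → ∀ ν : ℕ, 2 ≤ ν →
      ‖f (p ^ ν)‖ ≤ K * (ν : ℝ) ^ l * (p : ℝ) ^ ν) :
    ∃ c > (0 : ℝ), ∃ x₀ : ℝ, 3 ≤ x₀ ∧ ∀ x ≥ x₀,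
      ‖(∑ n ∈ Finset.Icc 1 ⌊x⌋₊, f n) -
          ((Real.pi ^ 2 * x ^ 2 / (12 * Real.log x) : ℝ) : ℂ)‖ ≤
        c * x ^ 2 / (Real.log x) ^ 2 := by
  obtain ⟨l, K, hK⟩ := hbound
  obtain ⟨C, hC, hS⟩ := Sz_avg
  obtain ⟨C', hC', hH⟩ := hz8_sum
  have hl2 := Real.log_pos one_lt_two
  have hev := (Real.isLittleO_pow_log_id_atTop (n := 2 * (l + 2))).def one_pos
  rw [Filter.eventually_atTop] at hev
  obtain ⟨y, hy⟩ := hev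
  set A := (|K| + 1) / Real.log 2 ^ l / Real.log 2 * C' with hA
  have hA0 : 0 ≤ A := by positivity
  refine ⟨C + A, by positivity, max 81 y, le_max_of_le_left (by norm_num), fun x hx => ?_⟩
  have hx81 : 81 ≤ x := (le_max_left _ _).trans hx
  have hxy := hy x ((le_max_right _ _).trans hx)
  have hL := log_ge_two (show 8 ≤ x by linarith)
  set N := ⌊x⌋₊ with hN
  have hNx : (N : ℝ) ≤ x := Nat.floor_le (by linarith)
  have h1 := hS x hx81
  rw [← hN] at h1
  have e1 : ∑ k ∈ Finset.Icc 1 N, Sz ⌊x / k⌋₊ = ∑ n ∈ Finset.Icc 1 N, ∑ p ∈ n.primeFactors, (p : ℝ) := by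
    rw [sum_primeFactors_eq]
    refine Finset.sum_congr rfl fun k _ => ?_
    rw [Nat.floor_div_natCast]
  rw [e1] at h1
  set T := ∑ n ∈ Finset.Icc 1 N, ∑ p ∈ n.primeFactors, (p : ℝ) with hT
  have h2 : ‖(∑ n ∈ Finset.Icc 1 N, f n) - (T : ℂ)‖ ≤ A * (x ^ 2 / Real.log x ^ 2) := by
    rw [hT, Complex.ofReal_sum, ← Finset.sum_sub_distrib]
    refine (norm_sum_le _ _).trans ?_
    calc _ ≤ ∑ n ∈ Finset.Icc 1 N, (|K| + 1) * (Real.log x / Real.log 2) ^ l / Real.log 2 * ∑ d ∈ n.divisors, hz8 d := by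
          refine Finset.sum_le_sum fun n hn => ?_
          rw [Finset.mem_Icc] at hn
          refine diff_bound f hadd hp1 l K hK n (by omega) x (le_trans ?_ hNx)
          exact_mod_cast hn.2
      _ = (|K| + 1) * (Real.log x / Real.log 2) ^ l / Real.log 2 * ∑ n ∈ Finset.Icc 1 N, ∑ d ∈ n.divisors, hz8 d := by
          rw [← Finset.mul_sum]
      _ ≤ (|K| + 1) * (Real.log x / Real.log 2) ^ l / Real.log 2 * (C' * (x * Real.sqrt x)) := by
          gcongr
          refine (hH N).trans ?_
          gcongr
      _ = A * (x * (Real.sqrt x * Real.log x ^ l)) := by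
          rw [hA, div_pow]; field_simp
      _ ≤ A * (x ^ 2 / Real.log x ^ 2) := by
          gcongr
          rw [le_div_iff₀ (by positivity)]
          have : Real.log x ^ (l + 2) ≤ Real.sqrt x := by
            refine Real.le_sqrt_of_sq_le ?_
            rw [← pow_mul, mul_comm]
            rw [one_mul, Real.norm_of_nonneg (by positivity), id, Real.norm_of_nonneg (by linarith)] at hxy
            exact hxy
          calc _ = x * (Real.sqrt x * Real.log x ^ (l + 2)) := by ring
            _ ≤ x * (Real.sqrt x * Real.sqrt x) := by gcongr
            _ = x ^ 2 := by rw [Real.mul_self_sqrt (by linarith)]; ring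
  have h3 : ‖(T : ℂ) - ((Real.pi ^ 2 * x ^ 2 / (12 * Real.log x) : ℝ) : ℂ)‖ ≤ C * (x ^ 2 / Real.log x ^ 2) := by
    rw [← Complex.ofReal_sub, Complex.norm_real, Real.norm_eq_abs]; exact h1
  refine (norm_sub_le_norm_sub_add_norm_sub _ (T : ℂ) _).trans ?_
  have e : (C + A) * x ^ 2 / Real.log x ^ 2 = C * (x ^ 2 / Real.log x ^ 2) + A * (x ^ 2 / Real.log x ^ 2) := by ring
  rw [e]; linarith
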